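/- arXiv:1207.4302 — 2 statements merged into one kernel-verified Lean document; each statement's English description precedes it below -/
import Mathlib

section
/- If f(z) = z + Σ_{k=2}^∞ a_k z^k is a normalized analytic function on the unit disk 𝔻 that is injective on 𝔻, then for every n ≥ 2 the n-th partial sum f_n(z) = z + Σ_{k=2}^n a_k z^k is injective on the disk {z : |z| < 1/4}. -/
open Complex Metric Finset
open MeasureTheory Filter Topology
open scoped ComplexConjugate NNReal

theorem det_mul_add_conj (a c : ℂ) :
    (a • (1 : ℂ →L[ℝ] ℂ) + c • (conjCLE : ℂ →L[ℝ] ℂ)).det = ‖a‖ ^ 2 - ‖c‖ ^ 2 := by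
  rw [ContinuousLinearMap.det, ← LinearMap.det_toMatrix basisOneI, Matrix.det_fin_two]
  simp [LinearMap.toMatrix_apply, Complex.sq_norm, Complex.normSq_apply]
  ring

/-- The inversion `ζ ↦ 1 / ζ` outside the disk of radius `R`, continued to the inside of that disk
by the linear map `ζ ↦ conj ζ / R ^ 2`. -/
noncomputable def truncInv (R : ℝ) (ζ : ℂ) : ℂ := conj ζ / ((max ‖ζ‖ R : ℝ) : ℂ) ^ 2

theorem truncInv_of_le {R : ℝ} {ζ : ℂ} (h : R ≤ ‖ζ‖) : truncInv R ζ = ζ⁻¹ := by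
  rw [truncInv, max_eq_left h, Complex.inv_def, Complex.normSq_eq_norm_sq]
  push_cast
  rw [div_eq_mul_inv]

theorem norm_truncInv_le {R : ℝ} (hR : 0 < R) (ζ : ℂ) : ‖truncInv R ζ‖ ≤ 1 / R := by
  have hm : R ≤ max ‖ζ‖ R := le_max_right _ _
  have hm' : ‖ζ‖ ≤ max ‖ζ‖ R := le_max_left _ _
  have h0 : 0 < max ‖ζ‖ R := hR.trans_le hm
  rw [truncInv, norm_div, norm_pow, Complex.norm_real, Real.norm_of_nonneg h0.le,
    RCLike.norm_conj, div_le_div_iff₀ (by positivity) hR]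
  nlinarith

theorem norm_truncInv_sub_le {R : ℝ} (hR : 0 < R) (ζ ω : ℂ) :
    ‖truncInv R ζ - truncInv R ω‖ ≤ 3 / R ^ 2 * ‖ζ - ω‖ := by
  set m := max ‖ζ‖ R with hm
  set n := max ‖ω‖ R with hn
  have hRm : R ≤ m := le_max_right _ _
  have hRn : R ≤ n := le_max_right _ _
  have hωn : ‖ω‖ ≤ n := le_max_left _ _
  have hm0 : 0 < m := hR.trans_le hRm
  have hn0 : 0 < n := hR.trans_le hRn
  have hmn : |n - m| ≤ ‖ζ - ω‖ := by
    rw [hm, hn, abs_sub_comm]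
    calc _ ≤ |‖ζ‖ - ‖ω‖| := abs_max_sub_max_le_abs _ _ _
      _ ≤ _ := abs_norm_sub_norm_le _ _
  have hmc : (m : ℂ) ≠ 0 := by exact_mod_cast hm0.ne'
  have hnc : (n : ℂ) ≠ 0 := by exact_mod_cast hn0.ne'
  have key : truncInv R ζ - truncInv R ω
      = conj (ζ - ω) / (m : ℂ) ^ 2 + conj ω * (((n - m) * (n + m) : ℝ) : ℂ) / ((m : ℂ) ^ 2 * n ^ 2) := by
    simp only [truncInv, ← hm, ← hn, map_sub]
    push_cast
    field_simp
    ring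
  rw [key]
  refine (norm_add_le _ _).trans ?_
  simp only [norm_div, norm_mul, norm_pow, RCLike.norm_conj, Complex.norm_real,
    Real.norm_of_nonneg hm0.le, Real.norm_of_nonneg hn0.le, Real.norm_eq_abs,
    abs_of_pos (add_pos hn0 hm0)]
  have h1 : ‖ζ - ω‖ / m ^ 2 ≤ ‖ζ - ω‖ / R ^ 2 := by gcongr
  have h2 : ‖ω‖ * (|n - m| * (n + m)) / (m ^ 2 * n ^ 2) ≤ 2 * ‖ζ - ω‖ / R ^ 2 := by
    calc _ ≤ n * (‖ζ - ω‖ * (n + m)) / (m ^ 2 * n ^ 2) := by gcongr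
      _ = ‖ζ - ω‖ * (1 / m ^ 2 + 1 / (m * n)) := by field_simp
      _ ≤ ‖ζ - ω‖ * (1 / R ^ 2 + 1 / (R * R)) := by gcongr
      _ = _ := by field_simp; ring
  calc _ ≤ ‖ζ - ω‖ / R ^ 2 + 2 * ‖ζ - ω‖ / R ^ 2 := add_le_add h1 h2
    _ = _ := by ring

/-- Values which `z⁻¹ + H z` does not take near the pole are taken by the harmonic extension of
the restriction of `z⁻¹ + H z` to the circle `‖z‖ = r`. -/
theorem exists_add_comp_conj_eq {H : ℂ → ℂ} {K : ℝ≥0} {r : ℝ} (hr : 0 < r) (hr2 : r ≤ 1 / 2)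
    (hK : LipschitzOnWith K H (closedBall 0 (1 / 2))) (hKr : 3 * r ^ 2 * K < 1) {v : ℂ}
    (hv : ∀ z : ℂ, z ≠ 0 → ‖z‖ ≤ r → z⁻¹ + H z ≠ v) :
    ∃ ζ ∈ ball (0 : ℂ) (1 / r), ζ + H (r ^ 2 * conj ζ) = v := by
  have hR : 0 < 1 / r := by positivity
  have hmem (ζ : ℂ) : truncInv (1 / r) ζ ∈ closedBall (0 : ℂ) (1 / 2) := by
    rw [mem_closedBall_zero_iff]
    refine (norm_truncInv_le hR ζ).trans ?_
    simpa using hr2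
  have hc : ContractingWith (Real.toNNReal (3 * r ^ 2 * K))
      (fun ζ => v - H (truncInv (1 / r) ζ)) := by
    refine ⟨by rw [← NNReal.coe_lt_coe, Real.coe_toNNReal _ (by positivity)]; exact_mod_cast hKr,
      LipschitzWith.of_dist_le_mul fun ζ ω => ?_⟩
    rw [Real.coe_toNNReal _ (by positivity), dist_sub_left]
    calc _ ≤ K * dist (truncInv (1 / r) ζ) (truncInv (1 / r) ω) :=
          hK.dist_le_mul _ (hmem _) _ (hmem _)
      _ ≤ K * (3 / (1 / r) ^ 2 * ‖ζ - ω‖) := by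
          gcongr
          rw [dist_eq_norm]
          exact norm_truncInv_sub_le hR _ _
      _ = _ := by rw [dist_eq_norm]; field_simp
  obtain ⟨ζ, hζ⟩ : ∃ ζ, v - H (truncInv (1 / r) ζ) = ζ := ⟨_, hc.fixedPoint_isFixedPt⟩
  rcases le_or_gt (1 / r) ‖ζ‖ with h | h
  · have h0 : ζ ≠ 0 := norm_pos_iff.1 (hR.trans_le h)
    rw [truncInv_of_le h] at hζ
    refine absurd ?_ (hv ζ⁻¹ (inv_ne_zero h0) ?_)
    · rw [inv_inv]; linear_combination -hζ
    · rw [norm_inv]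
      exact inv_le_of_inv_le₀ hr (by simpa using h)
  · refine ⟨ζ, by simpa using h, ?_⟩
    have : truncInv (1 / r) ζ = r ^ 2 * conj ζ := by
      rw [truncInv, max_eq_right h.le]
      push_cast
      field_simp
    rw [this] at hζ
    linear_combination -hζ

theorem volume_image_add_comp_conj_le {H : ℂ → ℂ} {K : ℝ≥0} {r : ℝ} (hr : 0 < r) (hr2 : r ≤ 1 / 2)
    (hH : DifferentiableOn ℂ H (ball 0 1))
    (hK : LipschitzOnWith K H (closedBall 0 (1 / 2))) (hKr : 3 * r ^ 2 * K < 1) :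
    volume ((fun ζ : ℂ => ζ + H (r ^ 2 * conj ζ)) '' ball 0 (1 / r)) ≤
      ENNReal.ofReal (Real.pi / r ^ 2) := by
  have hmem : ∀ ζ ∈ ball (0 : ℂ) (1 / r), (r : ℂ) ^ 2 * conj ζ ∈ ball (0 : ℂ) (1 / 2) := by
    intro ζ hζ
    rw [mem_ball_zero_iff] at hζ ⊢
    rw [norm_mul, norm_pow, RCLike.norm_conj, Complex.norm_real, Real.norm_of_nonneg hr.le]
    calc r ^ 2 * ‖ζ‖ < r ^ 2 * (1 / r) := by gcongr
      _ = r := by field_simp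
      _ ≤ _ := hr2
  have hd : ∀ ζ ∈ ball (0 : ℂ) (1 / r), HasFDerivWithinAt (fun ζ : ℂ => ζ + H (r ^ 2 * conj ζ))
      ((1 : ℂ) • (1 : ℂ →L[ℝ] ℂ) + (deriv H (r ^ 2 * conj ζ) * r ^ 2) • (conjCLE : ℂ →L[ℝ] ℂ))
      (ball 0 (1 / r)) ζ := by
    intro ζ hζ
    have h1 : HasDerivAt H (deriv H (r ^ 2 * conj ζ)) (r ^ 2 * conj ζ) :=
      (hH.differentiableAt (isOpen_ball.mem_nhds
        (ball_subset_ball (by norm_num) (hmem ζ hζ)))).hasDerivAt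
    have h2 : HasFDerivAt (fun ζ : ℂ => (r : ℂ) ^ 2 * conj ζ)
        ((r : ℂ) ^ 2 • (conjCLE : ℂ →L[ℝ] ℂ)) ζ :=
      (conjCLE : ℂ →L[ℝ] ℂ).hasFDerivAt.const_mul _
    have h3 := (h1.hasFDerivAt.restrictScalars ℝ).comp ζ h2
    refine (((hasFDerivAt_id ζ).add h3).congr_fderiv ?_).hasFDerivWithinAt
    ext
    all_goals simp
    all_goals ring
  refine (addHaar_image_le_lintegral_abs_det_fderiv volume measurableSet_ball hd).trans ?_
  have hle : ∀ ζ ∈ ball (0 : ℂ) (1 / r), ENNReal.ofReal |((1 : ℂ) • (1 : ℂ →L[ℝ] ℂ) +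
      (deriv H (r ^ 2 * conj ζ) * r ^ 2) • (conjCLE : ℂ →L[ℝ] ℂ)).det| ≤ 1 := by
    intro ζ hζ
    rw [det_mul_add_conj, ENNReal.ofReal_le_one]
    have hder : ‖deriv H (r ^ 2 * conj ζ)‖ ≤ K :=
      norm_deriv_le_of_lipschitzOn (closedBall_mem_nhds_of_mem (hmem ζ hζ)) hK
    have hb : ‖deriv H (r ^ 2 * conj ζ) * (r : ℂ) ^ 2‖ ≤ 1 := by
      rw [norm_mul, norm_pow, Complex.norm_real, Real.norm_of_nonneg hr.le]
      nlinarith [mul_le_mul_of_nonneg_right hder (sq_nonneg r)]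
    rw [norm_one, abs_le]
    constructor <;> nlinarith [norm_nonneg (deriv H (r ^ 2 * conj ζ) * (r : ℂ) ^ 2)]
  calc _ ≤ ∫⁻ _ζ in ball (0 : ℂ) (1 / r), 1 := setLIntegral_mono measurable_const hle
    _ = ENNReal.ofReal (Real.pi / r ^ 2) := by
      rw [setLIntegral_one, Complex.volume_ball, ← ENNReal.ofReal_pow (by positivity),
        ← ENNReal.ofReal_coe_nnreal, ← ENNReal.ofReal_mul (by positivity)]
      congr 1
      simp [field]

/-- The coefficients of the Taylor series at the origin. -/
noncomputable def taylorCoeff (F : ℂ → ℂ) (k : ℕ) : ℂ := iteratedDeriv k F 0 / (k.factorial : ℂ)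

theorem hasSum_taylorCoeff {F : ℂ → ℂ} (hF : DifferentiableOn ℂ F (ball 0 1)) {z : ℂ}
    (hz : z ∈ ball (0 : ℂ) 1) : HasSum (fun k => taylorCoeff F k * z ^ k) (F z) := by
  convert! hasSum_taylorSeries_on_ball hF hz using 2 with k
  simp [taylorCoeff, div_eq_inv_mul]
  ring

theorem eball_one_eq_ball : Metric.eball (0 : ℂ) 1 = ball 0 1 := by
  simpa using Metric.eball_coe (x := (0 : ℂ)) (ε := 1)

theorem hasFPowerSeriesOnBall_of_hasSum {F : ℂ → ℂ} {c : ℕ → ℂ}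
    (h : ∀ z ∈ ball (0 : ℂ) 1, HasSum (fun k => c k * z ^ k) (F z)) :
    HasFPowerSeriesOnBall F (FormalMultilinearSeries.ofScalars ℂ c) 0 1 := by
  refine ⟨?_, one_pos, fun {y} hy => ?_⟩
  · refine ENNReal.le_of_forall_nnreal_lt fun r hr => ?_
    refine FormalMultilinearSeries.le_radius_of_summable _ ?_
    have hr1 : ((r : ℝ) : ℂ) ∈ ball (0 : ℂ) 1 := by
      have : r < 1 := by exact_mod_cast hr
      simpa using this
    simpa using (h _ hr1).summable.norm
  · rw [eball_one_eq_ball] at hy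
    simpa [FormalMultilinearSeries.ofScalars_apply_eq, mul_comm] using h y hy

theorem differentiableOn_of_hasSum {F : ℂ → ℂ} {c : ℕ → ℂ}
    (h : ∀ z ∈ ball (0 : ℂ) 1, HasSum (fun k => c k * z ^ k) (F z)) :
    DifferentiableOn ℂ F (ball 0 1) := by
  simpa only [eball_one_eq_ball] using (hasFPowerSeriesOnBall_of_hasSum h).differentiableOn

theorem taylorCoeff_eq_of_hasSum {F : ℂ → ℂ} {c : ℕ → ℂ}
    (h : ∀ z ∈ ball (0 : ℂ) 1, HasSum (fun k => c k * z ^ k) (F z)) : taylorCoeff F = c := by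
  have h1 := (hasFPowerSeriesOnBall_of_hasSum h).hasFPowerSeriesAt.eq_formalMultilinearSeries
    (hasFPowerSeriesOnBall_of_hasSum
      fun z hz => hasSum_taylorCoeff (differentiableOn_of_hasSum h) hz).hasFPowerSeriesAt
  funext k
  have := congrArg (fun p => FormalMultilinearSeries.coeff p k) h1
  simpa using this.symm

theorem taylorCoeff_deriv (F : ℂ → ℂ) (k : ℕ) :
    taylorCoeff (deriv F) k = (k + 1) * taylorCoeff F (k + 1) := by
  rw [taylorCoeff, taylorCoeff, iteratedDeriv_succ', Nat.factorial_succ]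
  have : ((k : ℂ) + 1) ≠ 0 := by exact_mod_cast k.succ_ne_zero
  have := k.factorial_ne_zero
  push_cast
  field_simp

theorem taylorCoeff_mul {F G : ℂ → ℂ} (hF : DifferentiableOn ℂ F (ball 0 1))
    (hG : DifferentiableOn ℂ G (ball 0 1)) (k : ℕ) :
    taylorCoeff (fun z => F z * G z) k
      = ∑ i ∈ range (k + 1), taylorCoeff F i * taylorCoeff G (k - i) := by
  have h0 : ball (0 : ℂ) 1 ∈ 𝓝 0 := ball_mem_nhds _ one_pos
  have := iteratedDeriv_mul (n := k) (hF.analyticAt h0).contDiffAt (hG.analyticAt h0).contDiffAt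
  rw [taylorCoeff, show (fun z => F z * G z) = F * G from rfl, this, Finset.sum_div]
  refine Finset.sum_congr rfl fun i hi => ?_
  have hik : i ≤ k := by simpa [Nat.lt_succ_iff] using hi
  rw [taylorCoeff, taylorCoeff, Nat.cast_choose ℂ hik]
  have h1 := i.factorial_ne_zero
  have h2 := k.factorial_ne_zero
  have h3 := (k - i).factorial_ne_zero
  field_simp

theorem taylorCoeff_congr {F G : ℂ → ℂ} (h : Set.EqOn F G (ball 0 1)) :
    taylorCoeff F = taylorCoeff G := by
  funext k
  rw [taylorCoeff, taylorCoeff,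
    (Filter.eventuallyEq_of_mem (ball_mem_nhds _ one_pos) h).iteratedDeriv_eq]

theorem taylorCoeff_zero (F : ℂ → ℂ) : taylorCoeff F 0 = F 0 := by
  simp [taylorCoeff]

/-- **Bessel's inequality** on the unit circle. -/
theorem sum_norm_sq_le_circleAverage {c : ℕ → ℂ} {W : ℂ → ℂ} (hc : Summable fun j => ‖c j‖)
    (hW : ∀ z : ℂ, ‖z‖ = 1 → HasSum (fun j => c j * z ^ j) (W z)) (N : ℕ) :
    ∑ j ∈ range N, ‖c j‖ ^ 2 ≤ Real.circleAverage (fun z => ‖W z‖ ^ 2) 0 1 := by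
  have hcm (θ : ℝ) : ‖circleMap 0 1 θ‖ = 1 := by simp
  have hlim : Tendsto (fun M => Real.circleAverage (fun z => ‖∑ j ∈ range M, c j * z ^ j‖ ^ 2) 0 1)
      atTop (𝓝 (Real.circleAverage (fun z => ‖W z‖ ^ 2) 0 1)) := by
    refine Tendsto.const_smul ?_ _
    refine intervalIntegral.tendsto_integral_filter_of_dominated_convergence
      (fun _ => (∑' j, ‖c j‖) ^ 2) ?_ ?_ (by simp) ?_
    · refine Eventually.of_forall fun M => Continuous.aestronglyMeasurable ?_
      fun_prop
    · refine Eventually.of_forall fun M => ae_of_all _ fun θ _ => ?_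
      rw [norm_pow, norm_norm]
      gcongr
      refine (norm_sum_le _ _).trans ?_
      simpa only [norm_mul, norm_pow, hcm, one_pow, mul_one] using
        hc.sum_le_tsum _ (fun _ _ => norm_nonneg _)
    · refine ae_of_all _ fun θ _ => ?_
      exact ((hW _ (hcm θ)).tendsto_sum_nat.norm).pow 2
  refine ge_of_tendsto hlim ?_
  filter_upwards [eventually_ge_atTop N] with M hM
  set p : Polynomial ℂ := ∑ j ∈ range M, Polynomial.monomial j (c j) with hp
  have hcoeff (j : ℕ) : p.coeff j = if j < M then c j else 0 := by
    simp [hp, Polynomial.coeff_monomial]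
  have heval : (fun z => ‖∑ j ∈ range M, c j * z ^ j‖ ^ 2) = fun z => ‖p.eval z‖ ^ 2 := by
    funext z
    simp [hp, Polynomial.eval_finsetSum]
  rw [heval, ← Polynomial.sum_sq_norm_coeff_eq_circleAverage]
  have hsub : p.support ⊆ range M := by
    intro j hj
    by_contra h
    simp [hcoeff] at hj h
    omega
  rw [Finset.sum_subset hsub (fun j _ hj => by simp [Polynomial.notMem_support_iff.1 hj])]
  calc ∑ j ∈ range N, ‖c j‖ ^ 2 ≤ ∑ j ∈ range M, ‖c j‖ ^ 2 :=
        Finset.sum_le_sum_of_subset_of_nonneg (range_mono hM) fun _ _ _ => by positivity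
    _ = _ := Finset.sum_congr rfl fun j hj => by simp [hcoeff, Finset.mem_range.1 hj]

theorem summable_norm_taylorCoeff {F : ℂ → ℂ} (hF : DifferentiableOn ℂ F (ball 0 1)) {t : ℝ}
    (ht0 : 0 ≤ t) (ht1 : t < 1) : Summable fun k => ‖taylorCoeff F k‖ * t ^ k := by
  have ht : ((t : ℝ) : ℂ) ∈ ball (0 : ℂ) 1 := by simpa [abs_of_nonneg ht0] using ht1
  simpa [abs_of_nonneg ht0] using (hasSum_taylorCoeff hF ht).summable.norm

theorem le_circleAverage_sq_deriv {H : ℂ → ℂ} (hH : DifferentiableOn ℂ H (ball 0 1)) {t : ℝ}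
    (ht0 : 0 < t) (ht1 : t < 1) (N : ℕ) :
    (t ^ 4)⁻¹ + ∑ j ∈ range N, (j + 1) ^ 2 * ‖taylorCoeff H (j + 1)‖ ^ 2 * t ^ (2 * j) ≤
      Real.circleAverage (fun z => ‖-(z ^ 2)⁻¹ + deriv H z‖ ^ 2) 0 t := by
  have hH' : DifferentiableOn ℂ (deriv H) (ball 0 1) := hH.deriv isOpen_ball
  set c : ℕ → ℂ := fun j => match j with
    | 0 => -((t : ℂ) ^ 2)⁻¹
    | 1 => 0
    | k + 2 => taylorCoeff (deriv H) k * t ^ k with hc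
  have hcs : Summable fun j => ‖c j‖ := by
    rw [← summable_nat_add_iff 2]
    simpa [hc, abs_of_pos ht0] using summable_norm_taylorCoeff hH' ht0.le ht1
  have hW (z : ℂ) (hz : ‖z‖ = 1) :
      HasSum (fun j => c j * z ^ j) (-((t : ℂ) ^ 2)⁻¹ + z ^ 2 * deriv H (t * z)) := by
    rw [← hasSum_nat_add_iff' 2]
    have htz : (t : ℂ) * z ∈ ball (0 : ℂ) 1 := by simpa [hz, abs_of_pos ht0] using ht1
    convert! (hasSum_taylorCoeff hH' htz).mul_left (z ^ 2) using 1
    · funext k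
      simp only [hc]
      ring
    · simp [hc, Finset.sum_range_succ]
  have hB := sum_norm_sq_le_circleAverage hcs hW (N + 2)
  rw [Finset.sum_range_succ', Finset.sum_range_succ'] at hB
  rw [Real.circleAverage_eq_circleAverage_zero_one]
  have htc : (t : ℂ) ≠ 0 := by exact_mod_cast ht0.ne'
  have hcongr : Real.circleAverage (fun z : ℂ => ‖-(((t : ℂ) * z + 0) ^ 2)⁻¹ +
      deriv H ((t : ℂ) * z + 0)‖ ^ 2) 0 1 = Real.circleAverage (fun z : ℂ =>
        ‖-((t : ℂ) ^ 2)⁻¹ + z ^ 2 * deriv H (t * z)‖ ^ 2) 0 1 := by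
    refine Real.circleAverage_congr_sphere fun z hz => ?_
    have hz1 : ‖z‖ = 1 := by simpa using hz
    have hz0 : z ≠ 0 := by rintro rfl; simp at hz1
    have : -((t : ℂ) ^ 2)⁻¹ + z ^ 2 * deriv H (t * z)
        = z ^ 2 * (-(((t : ℂ) * z + 0) ^ 2)⁻¹ + deriv H ((t : ℂ) * z + 0)) := by
      rw [add_zero]
      field_simp
    simp only [this, norm_mul, norm_pow, hz1, one_pow, one_mul]
  rw [hcongr]
  refine le_trans (le_of_eq ?_) hB
  have h0 : ‖c 0‖ ^ 2 = (t ^ 4)⁻¹ := by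
    simp [hc]
    ring
  have h1 : ‖c (0 + 1)‖ ^ 2 = 0 := by simp [hc]
  rw [h0, h1, add_zero, add_comm]
  congr 1
  refine Finset.sum_congr rfl fun j _ => ?_
  have : c (j + 1 + 1) = (j + 1) * taylorCoeff H (j + 1) * t ^ j := by
    simp only [hc, taylorCoeff_deriv]
  rw [this, norm_mul, norm_mul, norm_pow, Complex.norm_real, Real.norm_of_nonneg ht0.le]
  have : ‖(j : ℂ) + 1‖ = (j : ℝ) + 1 := by exact_mod_cast Complex.norm_natCast (j + 1)
  rw [this]
  ring

theorem le_lintegral_annulus {H : ℂ → ℂ} (hH : DifferentiableOn ℂ H (ball 0 1)) {r ρ : ℝ}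
    (hr : 0 < r) (hrρ : r ≤ ρ) (hρ : ρ < 1) (N : ℕ) :
    ENNReal.ofReal (Real.pi * ((r ^ 2)⁻¹ - (ρ ^ 2)⁻¹ + ∑ j ∈ range N,
        (j + 1) * ‖taylorCoeff H (j + 1)‖ ^ 2 * (ρ ^ (2 * j + 2) - r ^ (2 * j + 2)))) ≤
      ∫⁻ z in {z : ℂ | r < ‖z‖ ∧ ‖z‖ < ρ},
        ENNReal.ofReal (‖-(z ^ 2)⁻¹ + deriv H z‖ ^ 2) := by
  set g : ℂ → ENNReal := fun z => ENNReal.ofReal (‖-(z ^ 2)⁻¹ + deriv H z‖ ^ 2) with hg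
  have hgm : Measurable g := by
    have := measurable_deriv H
    fun_prop
  have hAm : MeasurableSet {z : ℂ | r < ‖z‖ ∧ ‖z‖ < ρ} :=
    (measurableSet_lt measurable_const measurable_norm).inter
      (measurableSet_lt measurable_norm measurable_const)
  set b : ℝ → ℝ := fun t => (t ^ 4)⁻¹ +
    ∑ j ∈ range N, (j + 1) ^ 2 * ‖taylorCoeff H (j + 1)‖ ^ 2 * t ^ (2 * j) with hb
  have hpm : Measurable fun p : ℝ × ℝ => Complex.polarCoord.symm p := by
    simp only [Complex.polarCoord_symm_apply]
    fun_prop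
  rw [← lintegral_indicator hAm, ← Complex.lintegral_comp_polarCoord_symm,
    _root_.polarCoord_target, Measure.volume_eq_prod, ← Measure.prod_restrict, lintegral_prod]
  swap
  · refine Measurable.aemeasurable ?_
    have := (hgm.indicator hAm).comp hpm
    simp only [smul_eq_mul]
    exact (by fun_prop : Measurable fun p : ℝ × ℝ => ENNReal.ofReal p.1).mul this
  have hinner : ∀ t ∈ Set.Ioo r ρ, ENNReal.ofReal (2 * Real.pi * t * b t) ≤
      ∫⁻ θ in Set.Ioo (-Real.pi) Real.pi, ENNReal.ofReal t •
        ({z : ℂ | r < ‖z‖ ∧ ‖z‖ < ρ}.indicator g (Complex.polarCoord.symm (t, θ))) := by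
    intro t ht
    have ht0 : 0 < t := hr.trans ht.1
    have ht1 : t < 1 := ht.2.trans hρ
    have hcirc (θ : ℝ) : Complex.polarCoord.symm (t, θ) = circleMap 0 t θ := by
      simp [circleMap, Complex.exp_mul_I]
    have hnorm (θ : ℝ) : ‖circleMap 0 t θ‖ = t := by simp [abs_of_pos ht0]
    have hcont : Continuous fun θ : ℝ =>
        t * ‖-((circleMap 0 t θ) ^ 2)⁻¹ + deriv H (circleMap 0 t θ)‖ ^ 2 := by
      have h1 : Continuous fun θ : ℝ => deriv H (circleMap 0 t θ) :=
        (hH.deriv isOpen_ball).continuousOn.comp_continuous (by fun_prop) fun θ => by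
          simpa [abs_of_pos ht0] using ht1
      have h2 : ∀ θ : ℝ, (circleMap 0 t θ) ^ 2 ≠ 0 := fun θ => by
        simpa using ht0.ne'
      fun_prop (disch := assumption)
    have hEq (θ : ℝ) : ENNReal.ofReal t •
        ({z : ℂ | r < ‖z‖ ∧ ‖z‖ < ρ}.indicator g (Complex.polarCoord.symm (t, θ))) =
        ENNReal.ofReal
          (t * ‖-((circleMap 0 t θ) ^ 2)⁻¹ + deriv H (circleMap 0 t θ)‖ ^ 2) := by
      rw [hcirc, Set.indicator_of_mem (by simpa [abs_of_pos ht0] using ht), hg,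
        smul_eq_mul, ENNReal.ofReal_mul ht0.le]
    simp only [hEq]
    rw [← ofReal_integral_eq_lintegral_ofReal]
    · apply ENNReal.ofReal_le_ofReal
      have hle := le_circleAverage_sq_deriv hH ht0 ht1 N
      rw [Real.circleAverage_eq_integral_add (-Real.pi),
        intervalIntegral.integral_comp_add_right (fun θ : ℝ =>
          ‖-((circleMap 0 t θ) ^ 2)⁻¹ + deriv H (circleMap 0 t θ)‖ ^ 2) (-Real.pi),
        intervalIntegral.integral_of_le (by linarith [Real.pi_pos]),
        integral_Ioc_eq_integral_Ioo, smul_eq_mul, zero_add,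
        show 2 * Real.pi + -Real.pi = Real.pi by ring, inv_mul_eq_div,
        le_div_iff₀ (by positivity)] at hle
      rw [integral_const_mul]
      linarith [mul_le_mul_of_nonneg_left hle ht0.le]
    · exact (hcont.integrableOn_Icc).mono_set Set.Ioo_subset_Icc_self
    · exact ae_of_all _ fun θ => by positivity
  calc _ = ∫⁻ t in Set.Ioo r ρ, ENNReal.ofReal (2 * Real.pi * t * b t) := ?_
    _ ≤ _ := setLIntegral_mono' measurableSet_Ioo hinner
    _ ≤ _ := lintegral_mono_set fun t ht => hr.trans ht.1
  have hder : ∀ t ∈ Set.uIcc r ρ, HasDerivAt (fun t : ℝ => Real.pi * (-(t ^ 2)⁻¹ + ∑ j ∈ range N,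
        (j + 1) * ‖taylorCoeff H (j + 1)‖ ^ 2 * t ^ (2 * j + 2))) (2 * Real.pi * t * b t) t := by
    intro t ht
    rw [Set.uIcc_of_le hrρ] at ht
    have ht0 : t ≠ 0 := (hr.trans_le ht.1).ne'
    have h1 : HasDerivAt (fun t : ℝ => -(t ^ 2)⁻¹) (2 * t * (t ^ 4)⁻¹) t := by
      convert! ((hasDerivAt_pow 2 t).inv (pow_ne_zero 2 ht0)).neg using 1
      field_simp
      simp
    have h2 : HasDerivAt (fun t : ℝ => ∑ j ∈ range N,
        ((j : ℝ) + 1) * ‖taylorCoeff H (j + 1)‖ ^ 2 * t ^ (2 * j + 2))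
        (∑ j ∈ range N, ((j : ℝ) + 1) * ‖taylorCoeff H (j + 1)‖ ^ 2 *
          (((2 * j + 2 : ℕ) : ℝ) * t ^ (2 * j + 1))) t :=
      HasDerivAt.fun_sum fun j _ => (hasDerivAt_pow (2 * j + 2) t).const_mul _
    refine ((h1.add h2).const_mul Real.pi).congr_deriv ?_
    simp only [hb, mul_add, Finset.mul_sum]
    congr 1
    · ring
    · refine Finset.sum_congr rfl fun j _ => ?_
      push_cast
      ring
  have hbc : ContinuousOn (fun t => 2 * Real.pi * t * b t) (Set.uIcc r ρ) := by
    rw [Set.uIcc_of_le hrρ]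
    have : ∀ t ∈ Set.Icc r ρ, t ^ 4 ≠ 0 := fun t ht => pow_ne_zero 4 (hr.trans_le ht.1).ne'
    simp only [hb]
    fun_prop (disch := assumption)
  rw [← ofReal_integral_eq_lintegral_ofReal]
  · rw [← integral_Ioc_eq_integral_Ioo, ← intervalIntegral.integral_of_le hrρ,
      intervalIntegral.integral_eq_sub_of_hasDerivAt hder hbc.intervalIntegrable]
    congr 1
    simp only [mul_sub, Finset.sum_sub_distrib]
    ring
  · rw [Set.uIcc_of_le hrρ] at hbc
    exact (hbc.integrableOn_Icc).mono_set Set.Ioo_subset_Icc_self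
  · refine (ae_restrict_iff' measurableSet_Ioo).2 (ae_of_all _ fun t ht => ?_)
    have := hr.trans ht.1
    simp only [hb, Pi.zero_apply]
    positivity

theorem exists_lipschitzOnWith {H : ℂ → ℂ} (hH : DifferentiableOn ℂ H (ball 0 1)) :
    ∃ K : ℝ≥0, LipschitzOnWith K H (closedBall 0 (1 / 2)) := by
  have hsub : closedBall (0 : ℂ) (1 / 2) ⊆ ball 0 1 := closedBall_subset_ball (by norm_num)
  obtain ⟨C, hC⟩ := (isCompact_closedBall (0 : ℂ) (1 / 2)).exists_bound_of_continuousOn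
    ((hH.deriv isOpen_ball).continuousOn.mono hsub)
  exact ⟨C.toNNReal, Convex.lipschitzOnWith_of_nnnorm_deriv_le
    (fun z hz => hH.differentiableAt (isOpen_ball.mem_nhds (hsub hz)))
    (fun z hz => NNReal.coe_le_coe.1 ((hC z hz).trans (Real.le_coe_toNNReal C)))
    (convex_closedBall _ _)⟩

theorem sum_annulus_le {H : ℂ → ℂ} (hH : DifferentiableOn ℂ H (ball 0 1))
    (hinj : Set.InjOn (fun z => z⁻¹ + H z) (ball 0 1 \ {0})) {K : ℝ≥0} {r ρ : ℝ}
    (hr : 0 < r) (hr2 : r ≤ 1 / 2) (hrρ : r ≤ ρ) (hρ : ρ < 1)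
    (hK : LipschitzOnWith K H (closedBall 0 (1 / 2))) (hKr : 3 * r ^ 2 * K < 1) (N : ℕ) :
    ∑ j ∈ range N, (j + 1) * ‖taylorCoeff H (j + 1)‖ ^ 2 * (ρ ^ (2 * j + 2) - r ^ (2 * j + 2))
      ≤ (ρ ^ 2)⁻¹ := by
  set A : Set ℂ := {z | r < ‖z‖ ∧ ‖z‖ < ρ} with hA
  have hAm : MeasurableSet A :=
    (measurableSet_lt measurable_const measurable_norm).inter
      (measurableSet_lt measurable_norm measurable_const)
  have hA0 : ∀ z ∈ A, z ≠ 0 := fun z hz => norm_pos_iff.1 (hr.trans hz.1)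
  have hAball : ∀ z ∈ A, z ∈ ball (0 : ℂ) 1 := fun z hz =>
    mem_ball_zero_iff.2 (hz.2.trans hρ)
  have hder : ∀ z ∈ A, HasFDerivWithinAt (fun z => z⁻¹ + H z)
      ((-(z ^ 2)⁻¹ + deriv H z) • (1 : ℂ →L[ℝ] ℂ)) A z := fun z hz =>
    ((hasDerivAt_inv (hA0 z hz)).add
      (hH.differentiableAt (isOpen_ball.mem_nhds (hAball z hz))).hasDerivAt).complexToReal_fderiv
      |>.hasFDerivWithinAt
  have hvol := lintegral_abs_det_fderiv_eq_addHaar_image volume hAm hder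
    (hinj.mono (fun z hz => ⟨hAball z hz, hA0 z hz⟩ : A ⊆ ball 0 1 \ {0}))
  have hdet (c : ℂ) : |(c • (1 : ℂ →L[ℝ] ℂ)).det| = ‖c‖ ^ 2 := by
    have := det_mul_add_conj c 0
    have h0 : c • (1 : ℂ →L[ℝ] ℂ) + (0 : ℂ) • (conjCLE : ℂ →L[ℝ] ℂ) = c • 1 := by
      ext z
      simp
    rw [h0, norm_zero, zero_pow two_ne_zero, sub_zero] at this
    rw [this, abs_of_nonneg (by positivity)]
  simp only [hdet] at hvol
  have himage : (fun z => z⁻¹ + H z) '' A ⊆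
      (fun ζ : ℂ => ζ + H (r ^ 2 * conj ζ)) '' ball 0 (1 / r) := by
    rintro _ ⟨z, hz, rfl⟩
    refine exists_add_comp_conj_eq hr hr2 hK hKr fun w hw hwr heq => ?_
    have hw1 : w ∈ ball (0 : ℂ) 1 \ {0} :=
      ⟨mem_ball_zero_iff.2 (hwr.trans_lt (hrρ.trans_lt hρ)), hw⟩
    rw [hinj hw1 ⟨hAball z hz, hA0 z hz⟩ heq] at hwr
    exact hwr.not_gt hz.1
  have h := (le_lintegral_annulus hH hr hrρ hρ N).trans (hvol.le.trans
    ((measure_mono himage).trans (volume_image_add_comp_conj_le hr hr2 hH hK hKr)))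
  rw [ENNReal.ofReal_le_ofReal_iff (by positivity), div_eq_mul_inv,
    mul_le_mul_iff_right₀ Real.pi_pos] at h
  linarith

/-- **Gronwall's area theorem.** -/
theorem area_theorem {H : ℂ → ℂ} (hH : DifferentiableOn ℂ H (ball 0 1))
    (hinj : Set.InjOn (fun z => z⁻¹ + H z) (ball 0 1 \ {0})) (N : ℕ) :
    ∑ j ∈ range N, (j + 1) * ‖taylorCoeff H (j + 1)‖ ^ 2 ≤ 1 := by
  obtain ⟨K, hK⟩ := exists_lipschitzOnWith hH
  have hinner : ∀ ρ ∈ Set.Ioo (0 : ℝ) 1,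
      ∑ j ∈ range N, (j + 1) * ‖taylorCoeff H (j + 1)‖ ^ 2 * ρ ^ (2 * j + 2) ≤ (ρ ^ 2)⁻¹ := by
    intro ρ hρ
    have hlim : Tendsto (fun r : ℝ => ∑ j ∈ range N, (j + 1) * ‖taylorCoeff H (j + 1)‖ ^ 2 *
        (ρ ^ (2 * j + 2) - r ^ (2 * j + 2))) (𝓝[>] 0) (𝓝 (∑ j ∈ range N,
          (j + 1) * ‖taylorCoeff H (j + 1)‖ ^ 2 * ρ ^ (2 * j + 2))) := by
      refine Tendsto.mono_left (Continuous.tendsto' (by fun_prop) _ _ ?_) nhdsWithin_le_nhds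
      simp
    refine le_of_tendsto hlim ?_
    have hK0 : ∀ᶠ r : ℝ in 𝓝 0, 3 * r ^ 2 * K < 1 :=
      (Continuous.tendsto' (by fun_prop) 0 0 (by simp)).eventually_lt_const one_pos
    filter_upwards [self_mem_nhdsWithin, nhdsWithin_le_nhds hK0,
      nhdsWithin_le_nhds (Iic_mem_nhds hρ.1),
      nhdsWithin_le_nhds (Iic_mem_nhds (by norm_num : (0 : ℝ) < 1 / 2))] with r hr hKr hrρ hr2
    exact sum_annulus_le hH hinj hr hr2 hrρ hρ.2 hK hKr N
  have h1 : Tendsto (fun ρ : ℝ => ∑ j ∈ range N,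
      (j + 1) * ‖taylorCoeff H (j + 1)‖ ^ 2 * ρ ^ (2 * j + 2)) (𝓝[<] 1)
      (𝓝 (∑ j ∈ range N, (j + 1) * ‖taylorCoeff H (j + 1)‖ ^ 2)) :=
    Tendsto.mono_left (Continuous.tendsto' (by fun_prop) _ _ (by simp)) nhdsWithin_le_nhds
  have h2 : Tendsto (fun ρ : ℝ => (ρ ^ 2)⁻¹) (𝓝[<] 1) (𝓝 1) := by
    refine Tendsto.mono_left ?_ nhdsWithin_le_nhds
    simpa using ((continuous_pow 2).tendsto (1 : ℝ)).inv₀ (by simp)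
  exact le_of_tendsto_of_tendsto h1 h2
    (eventually_of_mem (Ioo_mem_nhdsLT one_pos) hinner)

theorem exists_sq_eq_on_ball {u : ℂ → ℂ} (hu : DifferentiableOn ℂ u (ball 0 1)) (h0 : u 0 = 1)
    (hne : ∀ z ∈ ball (0 : ℂ) 1, u z ≠ 0) :
    ∃ E : ℂ → ℂ, DifferentiableOn ℂ E (ball 0 1) ∧ E 0 = 1 ∧
      ∀ z ∈ ball (0 : ℂ) 1, E z ^ 2 = u z := by
  have hquot : DifferentiableOn ℂ (fun z => deriv u z / u z / 2) (ball 0 1) :=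
    ((hu.deriv isOpen_ball).div hu hne).div_const 2
  obtain ⟨g, hg0, hg⟩ := hquot.isExactOn_ball.with_val_at 0 0
  have hE : ∀ z ∈ ball (0 : ℂ) 1, HasDerivAt (fun z => exp (g z))
      (exp (g z) * (deriv u z / u z / 2)) z := fun z hz => (hg z hz).cexp
  refine ⟨fun z => exp (g z), fun z hz => (hE z hz).differentiableAt.differentiableWithinAt,
    by simp [hg0], fun z hz => ?_⟩
  have hder : ∀ z ∈ ball (0 : ℂ) 1, HasDerivAt (fun z => exp (g z) ^ 2 / u z) 0 z := by
    intro z hz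
    have hu' := (hu.differentiableAt (isOpen_ball.mem_nhds hz)).hasDerivAt
    have hz0 := hne z hz
    refine (((hE z hz).fun_pow 2).fun_div hu' hz0).congr_deriv ?_
    field_simp
    ring
  have hconst := isOpen_ball.is_const_of_deriv_eq_zero (convex_ball (0 : ℂ) 1).isPreconnected
    (fun z hz => (hder z hz).differentiableAt.differentiableWithinAt)
    (fun z hz => (hder z hz).deriv) hz (mem_ball_self one_pos)
  simp only [hg0, h0, exp_zero, one_pow, div_one] at hconst
  exact (div_eq_one_iff_eq (hne z hz)).1 hconst

theorem hasSum_dslope {q : ℂ → ℂ} (hq : DifferentiableOn ℂ q (ball 0 1)) {z : ℂ}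
    (hz : z ∈ ball (0 : ℂ) 1) :
    HasSum (fun k => taylorCoeff q (k + 1) * z ^ k) (dslope q 0 z) := by
  rcases eq_or_ne z 0 with rfl | hz0
  · have h := hasSum_single (f := fun k => taylorCoeff q (k + 1) * (0 : ℂ) ^ k) 0
      fun k hk => by simp [hk]
    simpa [dslope_same, taylorCoeff] using h
  · rw [dslope_of_ne q hz0, slope_def_field, div_eq_mul_inv, sub_zero]
    have h := ((hasSum_nat_add_iff' 1).2 (hasSum_taylorCoeff hq hz)).mul_right z⁻¹
    simp only [range_one, sum_singleton, taylorCoeff_zero, pow_zero, mul_one] at h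
    convert! h using 2 with k
    field_simp
    ring

theorem taylorCoeff_dslope {q : ℂ → ℂ} (hq : DifferentiableOn ℂ q (ball 0 1)) (k : ℕ) :
    taylorCoeff (dslope q 0) k = taylorCoeff q (k + 1) :=
  congrFun (taylorCoeff_eq_of_hasSum fun _ hz => hasSum_dslope hq hz) k

/-- The area theorem for a function with a pole at the origin, written as `q z / z`. -/
theorem area_theorem_inv_mul {q : ℂ → ℂ} (hq : DifferentiableOn ℂ q (ball 0 1)) (h0 : q 0 = 1)
    (hinj : Set.InjOn (fun z => z⁻¹ * q z) (ball 0 1 \ {0})) (N : ℕ) :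
    ∑ j ∈ range N, (j + 1) * ‖taylorCoeff q (j + 2)‖ ^ 2 ≤ 1 := by
  have heq : Set.EqOn (fun z => z⁻¹ * q z) (fun z => z⁻¹ + dslope q 0 z) (ball 0 1 \ {0}) := by
    intro z hz
    have hz0 : z ≠ 0 := hz.2
    simp only [dslope_of_ne q hz0, slope_def_field, h0]
    field_simp
    ring
  have h := area_theorem (H := dslope q 0)
    ((differentiableOn_dslope (ball_mem_nhds _ one_pos)).2 hq) (heq.injOn_iff.1 hinj) N
  simpa only [taylorCoeff_dslope hq] using h

theorem sq_mem_ball {z : ℂ} (hz : z ∈ ball (0 : ℂ) 1) : z ^ 2 ∈ ball (0 : ℂ) 1 := by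
  rw [mem_ball_zero_iff] at hz ⊢
  simpa using pow_lt_one₀ (norm_nonneg z) hz two_ne_zero

theorem taylorCoeff_comp_sq {s : ℂ → ℂ} (hs : DifferentiableOn ℂ s (ball 0 1)) (k : ℕ) :
    taylorCoeff (fun z => s (z ^ 2)) (2 * k) = taylorCoeff s k := by
  have hinj : Function.Injective fun k : ℕ => 2 * k := mul_right_injective₀ two_ne_zero
  have h := taylorCoeff_eq_of_hasSum (F := fun z => s (z ^ 2))
    (c := fun j => if Even j then taylorCoeff s (j / 2) else 0) fun z hz => by
      rw [← hinj.hasSum_iff]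
      · convert! hasSum_taylorCoeff hs (sq_mem_ball hz) using 2 with k
        simp [pow_mul]
      · intro j hj
        have : ¬ Even j := fun ⟨i, hi⟩ => hj ⟨i, by simp only; omega⟩
        simp [this]
  simp [h]

theorem sum_norm_taylorCoeff_sqrt_le {s : ℂ → ℂ} (hs : DifferentiableOn ℂ s (ball 0 1))
    (h0 : s 0 = 1) (hne : ∀ z ∈ ball (0 : ℂ) 1, s z ≠ 0)
    (hinj : Set.InjOn (fun z => z⁻¹ * s z ^ 2) (ball 0 1 \ {0})) (N : ℕ) :
    ∑ k ∈ range N, (2 * k + 1) * ‖taylorCoeff s (k + 1)‖ ^ 2 ≤ 1 := by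
  have hq : DifferentiableOn ℂ (fun z => s (z ^ 2)) (ball 0 1) :=
    hs.comp (by fun_prop) fun z hz => sq_mem_ball hz
  have hqinj : Set.InjOn (fun z : ℂ => z⁻¹ * s (z ^ 2)) (ball 0 1 \ {0}) := by
    intro z hz w hw hzw
    have hz0 : z ≠ 0 := hz.2
    have hw0 : w ≠ 0 := hw.2
    simp only at hzw
    have hsq : z ^ 2 = w ^ 2 := hinj ⟨sq_mem_ball hz.1, pow_ne_zero 2 hz0⟩
      ⟨sq_mem_ball hw.1, pow_ne_zero 2 hw0⟩ (by
        simp only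
        rw [← inv_pow, ← mul_pow, hzw, mul_pow, inv_pow])
    rw [hsq] at hzw
    exact inv_injective (mul_right_cancel₀ (hne _ (sq_mem_ball hw.1)) hzw)
  refine le_trans ?_ (area_theorem_inv_mul hq (by simpa using h0) hqinj (2 * N))
  induction N with
  | zero => simp
  | succ N ih =>
    have h : taylorCoeff (fun z => s (z ^ 2)) (2 * N + 2) = taylorCoeff s (N + 1) :=
      taylorCoeff_comp_sq hs (N + 1)
    rw [Finset.sum_range_succ, mul_add, Finset.sum_range_succ, Finset.sum_range_succ, h]
    push_cast
    have : 0 ≤ (2 * (N : ℝ) + 1 + 1) * ‖taylorCoeff (fun z => s (z ^ 2)) (2 * N + 1 + 2)‖ ^ 2 := by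
      positivity
    linarith

/-- The square root of `f z / z`, together with its reciprocal. -/
theorem exists_sqrt_div_self {f : ℂ → ℂ} (hf : DifferentiableOn ℂ f (ball 0 1)) (h0 : f 0 = 0)
    (h1 : taylorCoeff f 1 = 1) (hinj : Set.InjOn f (ball 0 1)) :
    ∃ E s : ℂ → ℂ, DifferentiableOn ℂ E (ball 0 1) ∧ DifferentiableOn ℂ s (ball 0 1) ∧
      E 0 = 1 ∧ s 0 = 1 ∧ (∀ z ∈ ball (0 : ℂ) 1, s z * E z = 1) ∧
      ∀ z ∈ ball (0 : ℂ) 1, E z * E z = dslope f 0 z := by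
  have hball : (0 : ℂ) ∈ ball (0 : ℂ) 1 := mem_ball_self one_pos
  have hu : DifferentiableOn ℂ (dslope f 0) (ball 0 1) :=
    (differentiableOn_dslope (ball_mem_nhds _ one_pos)).2 hf
  have hu0 : dslope f 0 0 = 1 := by simpa [taylorCoeff] using h1
  have hne : ∀ z ∈ ball (0 : ℂ) 1, dslope f 0 z ≠ 0 := by
    intro z hz
    rcases eq_or_ne z 0 with rfl | hz0
    · rw [hu0]
      exact one_ne_zero
    · rw [dslope_of_ne f hz0, slope_def_field, h0, sub_zero, sub_zero]
      exact div_ne_zero (fun h => hz0 (hinj hz hball (h.trans h0.symm))) hz0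
  obtain ⟨E, hE, hE0, hEu⟩ := exists_sq_eq_on_ball hu hu0 hne
  have hEne : ∀ z ∈ ball (0 : ℂ) 1, E z ≠ 0 := fun z hz h => hne z hz (by simp [← hEu z hz, h])
  exact ⟨E, fun z => (E z)⁻¹, hE, hE.inv hEne, hE0, by simp [hE0],
    fun z hz => inv_mul_cancel₀ (hEne z hz), fun z hz => by rw [← hEu z hz, sq]⟩

theorem taylorCoeff_succ_of_mul_eq_one {E s : ℂ → ℂ} (hE : DifferentiableOn ℂ E (ball 0 1))
    (hs : DifferentiableOn ℂ s (ball 0 1)) (hs0 : s 0 = 1)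
    (hsE : ∀ z ∈ ball (0 : ℂ) 1, s z * E z = 1) (k : ℕ) :
    taylorCoeff E (k + 1) =
      -∑ j ∈ range (k + 1), taylorCoeff s (j + 1) * taylorCoeff E (k - j) := by
  have h := taylorCoeff_mul hs hE (k + 1)
  rw [taylorCoeff_congr hsE, Finset.sum_range_succ', taylorCoeff_zero, hs0] at h
  have h1 : taylorCoeff (fun _ => (1 : ℂ)) (k + 1) = 0 := by simp [taylorCoeff, iteratedDeriv_const]
  simp only [h1, Nat.add_sub_add_right, Nat.sub_zero, one_mul] at h
  exact eq_neg_of_add_eq_zero_right h.symm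

theorem injOn_inv_mul_sq {f E s : ℂ → ℂ} (h0 : f 0 = 0) (hinj : Set.InjOn f (ball 0 1))
    (hsE : ∀ z ∈ ball (0 : ℂ) 1, s z * E z = 1)
    (hEf : ∀ z ∈ ball (0 : ℂ) 1, E z * E z = dslope f 0 z) :
    Set.InjOn (fun z => z⁻¹ * s z ^ 2) (ball 0 1 \ {0}) := by
  have heq : Set.EqOn (fun z => (f z)⁻¹) (fun z => z⁻¹ * s z ^ 2) (ball 0 1 \ {0}) := by
    intro z hz
    have hfz : f z = z * (E z * E z) := by
      rw [hEf z hz.1]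
      simpa [h0] using (sub_smul_dslope f 0 z).symm
    simp only [hfz, eq_inv_of_mul_eq_one_left (hsE z hz.1)]
    rw [mul_inv, ← sq, inv_pow]
  exact heq.injOn_iff.1 (inv_injective.injOn.comp (hinj.mono Set.sdiff_subset) (Set.mapsTo_image f _))

theorem sum_pow_div_le_one (N : ℕ) :
    ∑ j ∈ range N, ((200 : ℝ) / 241) ^ (2 * (j + 1)) / (2 * j + 1) ≤ 1 := by
  set x : ℝ := 200 / 241 with hx
  set T : ℕ → ℝ := fun N => ∑ j ∈ range N, x ^ (2 * (j + 1)) / (2 * j + 1) +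
    x ^ (2 * (N + 1)) / ((2 * N + 1) * (1 - x ^ 2)) with hT
  have hx1 : 0 < 1 - x ^ 2 := by norm_num [hx]
  have hanti : Antitone T := by
    refine antitone_nat_of_succ_le fun N => ?_
    simp only [hT]
    rw [Finset.sum_range_succ, add_assoc]
    gcongr
    have h1 : x ^ (2 * (N + 1 + 1)) / ((2 * ((N + 1 : ℕ) : ℝ) + 1) * (1 - x ^ 2)) ≤
        x ^ (2 * (N + 1 + 1)) / ((2 * (N : ℝ) + 1) * (1 - x ^ 2)) := by
      gcongr
      simp
    refine (add_le_add_right h1 _).trans (le_of_eq ?_)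
    field_simp
    ring
  have h8 : T 8 ≤ 1 := by
    simp only [hT, Finset.sum_range_succ, hx]
    norm_num
  have hle : ∑ j ∈ range (max N 8), x ^ (2 * (j + 1)) / (2 * j + 1) ≤ T (max N 8) := by
    simp only [hT]
    have : 0 ≤ x ^ (2 * (max N 8 + 1)) / ((2 * ((max N 8 : ℕ) : ℝ) + 1) * (1 - x ^ 2)) := by
      positivity
    linarith
  refine le_trans (Finset.sum_le_sum_of_subset_of_nonneg
    (Finset.range_mono (le_max_left N 8)) fun j _ _ => by positivity) (hle.trans
      ((hanti (le_max_right N 8)).trans h8))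

theorem norm_le_pow_of_recurrence {d e : ℕ → ℂ} (he0 : e 0 = 1)
    (he : ∀ k, e (k + 1) = -∑ j ∈ range (k + 1), d (j + 1) * e (k - j))
    (hd : ∀ N, ∑ k ∈ range N, (2 * k + 1) * ‖d (k + 1)‖ ^ 2 ≤ 1) (k : ℕ) :
    ‖e k‖ ≤ (241 / 200) ^ k := by
  induction k using Nat.strong_induction_on with
  | _ k ih =>
  cases k with
  | zero => simp [he0]
  | succ k =>
  have h1 : ‖e (k + 1)‖ ≤ ∑ j ∈ range (k + 1), ‖d (j + 1)‖ * ‖e (k - j)‖ := by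
    rw [he, norm_neg]
    exact (norm_sum_le _ _).trans (Finset.sum_le_sum fun j _ => norm_mul_le _ _)
  have h2 : (∑ j ∈ range (k + 1), ‖d (j + 1)‖ * ‖e (k - j)‖) ^ 2 ≤
      (∑ j ∈ range (k + 1), (2 * (j : ℝ) + 1) * ‖d (j + 1)‖ ^ 2) *
        ∑ j ∈ range (k + 1), ‖e (k - j)‖ ^ 2 / (2 * (j : ℝ) + 1) := by
    refine Finset.sum_sq_le_sum_mul_sum_of_sq_le_mul _ (fun j _ => by positivity)
      (fun j _ => by positivity) fun j _ => le_of_eq ?_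
    field_simp
  have h3 : ∑ j ∈ range (k + 1), ‖e (k - j)‖ ^ 2 / (2 * (j : ℝ) + 1) ≤
      ((241 / 200) ^ (k + 1)) ^ 2 := by
    have h4 : ∀ j ∈ range (k + 1), ‖e (k - j)‖ ^ 2 / (2 * (j : ℝ) + 1) ≤
        ((241 / 200) ^ (k + 1)) ^ 2 * ((200 / 241) ^ (2 * (j + 1)) / (2 * j + 1)) := by
      intro j hj
      rw [← mul_div_assoc]
      gcongr
      have hjk : k + 1 = (k - j) + (j + 1) := by have := mem_range.1 hj; omega
      calc ‖e (k - j)‖ ^ 2 ≤ ((241 / 200) ^ (k - j)) ^ 2 := by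
            gcongr
            exact ih _ (by omega)
        _ = ((241 / 200) ^ (k + 1)) ^ 2 * (200 / 241) ^ (2 * (j + 1)) := by
            have : ((241 / 200 : ℝ) ^ (j + 1)) ^ 2 * (200 / 241) ^ (2 * (j + 1)) = 1 := by
              rw [← pow_mul, mul_comm (j + 1), ← mul_pow]
              norm_num
            rw [hjk, pow_add, mul_pow, mul_assoc, this, mul_one]
    refine (Finset.sum_le_sum h4).trans ?_
    rw [← Finset.mul_sum]
    exact mul_le_of_le_one_right (by positivity) (sum_pow_div_le_one _)
  refine h1.trans (abs_le_of_sq_le_sq' (h2.trans ?_) (by positivity)).2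
  exact (mul_le_of_le_one_left (by positivity) (hd _)).trans h3

theorem norm_pow_succ_sub_pow_succ_le {x y : ℂ} {r : ℝ} (hx : ‖x‖ ≤ r) (hy : ‖y‖ ≤ r) (k : ℕ) :
    ‖x ^ (k + 1) - y ^ (k + 1)‖ ≤ (k + 1) * r ^ k * ‖x - y‖ := by
  have hr : 0 ≤ r := (norm_nonneg x).trans hx
  rw [← geom_sum₂_mul, norm_mul]
  gcongr
  calc ‖∑ i ∈ range (k + 1), x ^ i * y ^ (k + 1 - 1 - i)‖
      ≤ ∑ i ∈ range (k + 1), r ^ k := norm_sum_le_of_le _ fun i hi => by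
        have hik : k = i + (k - i) := by have := mem_range.1 hi; omega
        rw [norm_mul, norm_pow, norm_pow, Nat.add_sub_cancel]
        calc ‖x‖ ^ i * ‖y‖ ^ (k - i) ≤ r ^ i * r ^ (k - i) := by gcongr
          _ = r ^ k := by rw [← pow_add, ← hik]
    _ = (k + 1) * r ^ k := by simp

theorem sum_succ_mul_pow_le (N : ℕ) :
    ∑ k ∈ range N, ((k : ℝ) + 1) * (1 / 16) ^ k ≤ (16 / 15) ^ 2 := by
  have h := hasSum_choose_mul_geometric_of_norm_lt_one (𝕜 := ℝ) 1 (r := 1 / 16) (by norm_num)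
  norm_num [Nat.choose_one_right] at h ⊢
  exact sum_le_hasSum _ (fun k _ => by positivity) h

theorem norm_sub_le_norm_mul_sub_mul {b : ℕ → ℂ} (hb0 : b 0 = 1)
    (hb : ∀ N, ∑ j ∈ range N, ((j : ℝ) + 1) * ‖b (j + 2)‖ ^ 2 ≤ 1)
    {x y X Y : ℂ} (hx : ‖x‖ ≤ 1 / 4) (hy : ‖y‖ ≤ 1 / 4)
    (hX : HasSum (fun k => b k * x ^ k) X) (hY : HasSum (fun k => b k * y ^ k) Y) :
    14 / 15 * ‖x - y‖ ≤ ‖x * Y - y * X‖ := by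
  have h := (hasSum_nat_add_iff' 2).2 ((hY.mul_left x).sub (hX.mul_left y))
  have hbound (N : ℕ) : ‖∑ k ∈ range N, (x * (b (k + 2) * y ^ (k + 2)) -
      y * (b (k + 2) * x ^ (k + 2)))‖ ≤ 1 / 15 * ‖x - y‖ := by
    have hCS : (∑ k ∈ range N, ((k : ℝ) + 1) * ‖b (k + 2)‖ * (1 / 4) ^ k) ^ 2 ≤ (16 / 15) ^ 2 := by
      refine (Finset.sum_sq_le_sum_mul_sum_of_sq_le_mul _
        (f := fun k : ℕ => ((k : ℝ) + 1) * ‖b (k + 2)‖ ^ 2)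
        (g := fun k : ℕ => ((k : ℝ) + 1) * (1 / 16) ^ k) (fun k _ => by positivity)
        (fun k _ => by positivity) fun k _ => le_of_eq ?_).trans
          ((mul_le_of_le_one_left (by positivity) (hb N)).trans (sum_succ_mul_pow_le N))
      rw [show (1 / 16 : ℝ) = (1 / 4) ^ 2 by norm_num, ← pow_mul, mul_comm 2 k, pow_mul]
      ring
    have hCS' := abs_le_of_sq_le_sq' hCS (by norm_num)
    have hterm : ∀ k ∈ range N, ‖x * (b (k + 2) * y ^ (k + 2)) - y * (b (k + 2) * x ^ (k + 2))‖ ≤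
        1 / 16 * ‖x - y‖ * (((k : ℝ) + 1) * ‖b (k + 2)‖ * (1 / 4) ^ k) := by
      intro k _
      have : x * (b (k + 2) * y ^ (k + 2)) - y * (b (k + 2) * x ^ (k + 2)) =
          x * y * b (k + 2) * (y ^ (k + 1) - x ^ (k + 1)) := by ring
      rw [this, norm_mul, norm_mul, norm_mul, norm_sub_rev]
      have := norm_pow_succ_sub_pow_succ_le hx hy k
      calc ‖x‖ * ‖y‖ * ‖b (k + 2)‖ * ‖x ^ (k + 1) - y ^ (k + 1)‖
          ≤ 1 / 4 * (1 / 4) * ‖b (k + 2)‖ * ((k + 1) * (1 / 4) ^ k * ‖x - y‖) := by gcongr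
        _ = _ := by ring
    refine (norm_sum_le_of_le _ hterm).trans ?_
    rw [← Finset.mul_sum]
    nlinarith [norm_nonneg (x - y), hCS'.2]
  have hlim := le_of_tendsto' h.tendsto_sum_nat.norm hbound
  have hsplit : x * Y - y * X - ∑ k ∈ range 2, (x * (b k * y ^ k) - y * (b k * x ^ k)) =
      x * Y - y * X - (x - y) := by
    simp only [sum_range_succ, range_zero, sum_empty, hb0]
    ring
  rw [hsplit] at hlim
  have := norm_sub_norm_le (x - y) (x * Y - y * X)
  rw [norm_sub_rev (x - y)] at this
  linarith

theorem norm_le_of_hasSum {b : ℕ → ℂ} (hb0 : b 0 = 1)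
    (hb : ∀ N, ∑ j ∈ range N, ((j : ℝ) + 1) * ‖b (j + 2)‖ ^ 2 ≤ 1)
    {x X : ℂ} (hb1 : ‖b 1‖ ≤ 2) (hx : ‖x‖ ≤ 1 / 4)
    (hX : HasSum (fun k => b k * x ^ k) X) : ‖X‖ ≤ 1.565 := by
  have h := (hasSum_nat_add_iff' 2).2 hX
  have hbound (N : ℕ) : ‖∑ k ∈ range N, b (k + 2) * x ^ (k + 2)‖ ≤ 0.065 := by
    have hCS : (∑ k ∈ range N, ‖b (k + 2)‖ * (1 / 4) ^ k) ^ 2 ≤ (1.04) ^ 2 := by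
      refine (Finset.sum_sq_le_sum_mul_sum_of_sq_le_mul _
        (f := fun k : ℕ => ((k : ℝ) + 1) * ‖b (k + 2)‖ ^ 2)
        (g := fun k : ℕ => (1 / 16) ^ k) (fun k _ => by positivity)
        (fun k _ => by positivity) fun k _ => ?_).trans
          ((mul_le_of_le_one_left (by positivity) (hb N)).trans ?_)
      · rw [show (1 / 16 : ℝ) = (1 / 4) ^ 2 by norm_num, ← pow_mul, mul_comm 2 k, pow_mul, mul_pow]
        gcongr
        exact le_mul_of_one_le_left (by positivity) (by simp)
      · exact (sum_le_hasSum _ (fun k _ => by positivity)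
          (hasSum_geometric_of_lt_one (r := (1 / 16 : ℝ)) (by norm_num) (by norm_num))).trans
            (by norm_num)
    have hCS' := abs_le_of_sq_le_sq' hCS (by norm_num)
    have hterm : ∀ k ∈ range N, ‖b (k + 2) * x ^ (k + 2)‖ ≤
        1 / 16 * (‖b (k + 2)‖ * (1 / 4) ^ k) := by
      intro k _
      rw [norm_mul, norm_pow]
      calc ‖b (k + 2)‖ * ‖x‖ ^ (k + 2) ≤ ‖b (k + 2)‖ * (1 / 4) ^ (k + 2) := by gcongr
        _ = _ := by ring
    refine (norm_sum_le_of_le _ hterm).trans ?_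
    rw [← Finset.mul_sum]
    linarith [hCS'.2]
  have hlim := le_of_tendsto' h.tendsto_sum_nat.norm hbound
  have h2 : ‖∑ k ∈ range 2, b k * x ^ k‖ ≤ 1.5 := by
    simp only [sum_range_succ, range_zero, sum_empty, hb0, pow_zero, pow_one, zero_add, mul_one]
    refine (norm_add_le _ _).trans ?_
    rw [norm_one, norm_mul]
    nlinarith [norm_nonneg x, norm_nonneg (b 1)]
  have := norm_sub_norm_le X (∑ k ∈ range 2, b k * x ^ k)
  linarith

theorem norm_sub_le_of_sum_eq {a : ℕ → ℂ} (ha : ∀ k, ‖a (k + 1)‖ ≤ (k + 1) * (241 / 200) ^ k)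
    {x y X Y : ℂ} (hx : ‖x‖ ≤ 1 / 4) (hy : ‖y‖ ≤ 1 / 4) (hX : HasSum (fun k => a k * x ^ k) X)
    (hY : HasSum (fun k => a k * y ^ k) Y) {n : ℕ} (hn : 4 ≤ n)
    (heq : ∑ k ∈ range (n + 1), a k * x ^ k = ∑ k ∈ range (n + 1), a k * y ^ k) :
    ‖X - Y‖ ≤ 0.36 * ‖x - y‖ := by
  have h := (hasSum_nat_add_iff' (n + 1)).2 (hX.sub hY)
  rw [Finset.sum_sub_distrib, heq, sub_self, sub_zero] at h
  set q : ℝ := 241 / 800 with hq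
  have hq1 : ‖q‖ < 1 := by norm_num [hq]
  have hG : HasSum (fun k : ℕ => ((k : ℝ) + 1) ^ 2 * q ^ k)
      (2 * (1 / (1 - q) ^ 3) - 1 / (1 - q) ^ 2) := by
    convert! ((hasSum_choose_mul_geometric_of_norm_lt_one 2 hq1).mul_left 2).sub
      (hasSum_choose_mul_geometric_of_norm_lt_one 1 hq1) using 2 with k
    rw [Nat.choose_one_right, Nat.cast_choose_two]
    push_cast
    ring
  have hGn := ((hasSum_nat_add_iff' n).2 hG).mul_right ‖x - y‖
  have hterm (k : ℕ) : ‖a (k + (n + 1)) * x ^ (k + (n + 1)) - a (k + (n + 1)) * y ^ (k + (n + 1))‖ ≤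
      (((k + n : ℕ) : ℝ) + 1) ^ 2 * q ^ (k + n) * ‖x - y‖ := by
    rw [← mul_sub, norm_mul, ← add_assoc]
    calc _ ≤ ((((k + n : ℕ) : ℝ) + 1) * (241 / 200) ^ (k + n)) *
          ((((k + n : ℕ) : ℝ) + 1) * (1 / 4) ^ (k + n) * ‖x - y‖) := by
          gcongr
          · exact ha (k + n)
          · exact norm_pow_succ_sub_pow_succ_le hx hy (k + n)
      _ = _ := by
          rw [show q = 241 / 200 * (1 / 4) by norm_num [hq], mul_pow]
          ring
  refine (h.norm_le_of_bounded hGn hterm).trans ?_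
  gcongr
  have h4 : ∑ k ∈ range 4, ((k : ℝ) + 1) ^ 2 * q ^ k ≤ ∑ k ∈ range n, ((k : ℝ) + 1) ^ 2 * q ^ k :=
    Finset.sum_le_sum_of_subset_of_nonneg (Finset.range_mono hn) fun k _ _ => by positivity
  have h5 : 2 * (1 / (1 - q) ^ 3) - 1 / (1 - q) ^ 2 -
      ∑ k ∈ range 4, ((k : ℝ) + 1) ^ 2 * q ^ k ≤ 0.36 := by
    norm_num [hq, sum_range_succ]
  exact (sub_le_sub_left h4 _).trans h5

theorem le_norm_one_sub_two_mul_add_three_mul_sq (w : ℂ) :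
    0.8164 * (1 - 3 * ‖w‖ ^ 2) ≤ ‖1 - 2 * w + 3 * w ^ 2‖ := by
  have hid : ‖1 - 2 * w + 3 * w ^ 2‖ ^ 2 =
      2 / 3 * (1 - 3 * ‖w‖ ^ 2) ^ 2 + 1 / 3 * (6 * w.re - (1 + 3 * ‖w‖ ^ 2)) ^ 2 := by
    rw [Complex.sq_norm, Complex.sq_norm, Complex.normSq_apply, Complex.normSq_apply]
    simp only [Complex.add_re, Complex.sub_re,
      Complex.add_im, Complex.sub_im, Complex.mul_re, Complex.mul_im, sq, Complex.one_re,
      Complex.one_im, Complex.re_ofNat, Complex.im_ofNat]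
    ring
  refine (abs_le_of_sq_le_sq' ?_ (norm_nonneg _)).2
  rw [hid]
  nlinarith [sq_nonneg (1 - 3 * ‖w‖ ^ 2), sq_nonneg (6 * w.re - (1 + 3 * ‖w‖ ^ 2))]

theorem cubic_divided_difference_ne_zero {d₁ d₂ x y : ℂ} (hd : ‖d₁‖ ^ 2 + 3 * ‖d₂‖ ^ 2 ≤ 1)
    (hx : ‖x‖ ≤ 1 / 4) (hy : ‖y‖ ≤ 1 / 4) :
    1 + -2 * d₁ * (x + y) + (3 * d₁ ^ 2 - 2 * d₂) * (x ^ 2 + x * y + y ^ 2) ≠ 0 := by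
  set w := d₁ * (x + y) with hw
  have hxy : ‖x + y‖ ≤ 1 / 2 := (norm_add_le _ _).trans (by linarith)
  have hp : ‖x * y‖ ≤ 1 / 16 := by
    rw [norm_mul]
    nlinarith [norm_nonneg x, norm_nonneg y]
  have hh : ‖x ^ 2 + x * y + y ^ 2‖ ≤ 3 / 16 := by
    refine (norm_add₃_le).trans ?_
    rw [norm_pow, norm_pow]
    nlinarith [norm_nonneg x, norm_nonneg y]
  have hwd : ‖w‖ ^ 2 ≤ ‖d₁‖ ^ 2 / 4 := by
    rw [hw, norm_mul, mul_pow, div_eq_mul_inv]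
    gcongr
    nlinarith [norm_nonneg (x + y)]
  have h1 := le_norm_one_sub_two_mul_add_three_mul_sq w
  have h2 : ‖3 * d₁ ^ 2 * (x * y) + 2 * d₂ * (x ^ 2 + x * y + y ^ 2)‖ ≤
      3 / 16 * ‖d₁‖ ^ 2 + 3 / 8 * ‖d₂‖ := by
    refine (norm_add_le _ _).trans ?_
    rw [norm_mul _ (x * y), norm_mul _ (x ^ 2 + x * y + y ^ 2), norm_mul 3, norm_mul 2, norm_pow,
      Complex.norm_ofNat, Complex.norm_ofNat]
    nlinarith [norm_nonneg d₂, sq_nonneg ‖d₁‖]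
  intro h
  have heq : 1 - 2 * w + 3 * w ^ 2 =
      3 * d₁ ^ 2 * (x * y) + 2 * d₂ * (x ^ 2 + x * y + y ^ 2) := by
    rw [← sub_eq_zero, ← h, hw]
    ring
  rw [heq] at h1
  nlinarith [sq_nonneg (‖d₂‖ - 0.078)]

/-- Coefficient information on a normalized univalent function, in terms of the square root
`s = √(z / f z)`, with coefficients `d`, and of its square, with coefficients `b`. -/
theorem exists_univalent_coefficients {f : ℂ → ℂ} (hf : DifferentiableOn ℂ f (ball 0 1))
    (h0 : f 0 = 0) (h1 : taylorCoeff f 1 = 1) (hinj : Set.InjOn f (ball 0 1)) :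
    ∃ (d e b : ℕ → ℂ) (q : ℂ → ℂ), e 0 = 1 ∧ b 0 = 1 ∧ b 1 = 2 * d 1 ∧
      (∀ k, e (k + 1) = -∑ j ∈ range (k + 1), d (j + 1) * e (k - j)) ∧
      (∀ k, taylorCoeff f (k + 1) = ∑ i ∈ range (k + 1), e i * e (k - i)) ∧
      (∀ N, ∑ k ∈ range N, (2 * k + 1) * ‖d (k + 1)‖ ^ 2 ≤ 1) ∧
      (∀ N, ∑ j ∈ range N, (j + 1) * ‖b (j + 2)‖ ^ 2 ≤ 1) ∧
      ∀ z ∈ ball (0 : ℂ) 1, HasSum (fun k => b k * z ^ k) (q z) ∧ f z * q z = z := by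
  obtain ⟨E, s, hE, hs, hE0, hs0, hsE, hEf⟩ := exists_sqrt_div_self hf h0 h1 hinj
  have hsinj := injOn_inv_mul_sq h0 hinj hsE hEf
  have hss : DifferentiableOn ℂ (fun z => s z * s z) (ball 0 1) := hs.mul hs
  refine ⟨taylorCoeff s, taylorCoeff E, taylorCoeff (fun z => s z * s z), fun z => s z * s z,
    by rw [taylorCoeff_zero, hE0], by simp [taylorCoeff_zero, hs0], ?_,
    taylorCoeff_succ_of_mul_eq_one hE hs hs0 hsE, fun k => ?_,
    sum_norm_taylorCoeff_sqrt_le hs hs0 (fun z hz => left_ne_zero_of_mul_eq_one (hsE z hz)) hsinj,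
    area_theorem_inv_mul hss (by simp [hs0]) (by simpa only [sq] using hsinj),
    fun z hz => ⟨hasSum_taylorCoeff hss hz, ?_⟩⟩
  · rw [taylorCoeff_mul hs hs]
    simp [sum_range_succ, taylorCoeff_zero, hs0]
    ring
  · rw [← taylorCoeff_mul hE hE, taylorCoeff_congr hEf, taylorCoeff_dslope hf]
  · have hfz : f z = z * (E z * E z) := by
      rw [hEf z hz]
      simpa [h0] using (sub_smul_dslope f 0 z).symm
    linear_combination (s z * s z) * hfz + z * (s z * E z + 1) * hsE z hz

theorem norm_coeff_le {a e : ℕ → ℂ} (he : ∀ k, ‖e k‖ ≤ (241 / 200) ^ k)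
    (ha : ∀ k, a (k + 1) = ∑ i ∈ range (k + 1), e i * e (k - i)) (k : ℕ) :
    ‖a (k + 1)‖ ≤ (k + 1) * (241 / 200) ^ k := by
  rw [ha]
  refine (norm_sum_le_of_le (f := fun i => e i * e (k - i))
    (n := fun _ => (241 / 200 : ℝ) ^ k) _ fun i hi => ?_).trans (by simp)
  have hik : i + (k - i) = k := by have := mem_range.1 hi; omega
  calc ‖e i * e (k - i)‖ ≤ (241 / 200) ^ i * (241 / 200) ^ (k - i) := by
        rw [norm_mul]
        exact mul_le_mul (he i) (he _) (norm_nonneg _) (by positivity)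
    _ = (241 / 200) ^ k := by rw [← pow_add, hik]

/-- Szegő's theorem: the n-th partial sum (n ≥ 2) of a univalent normalized analytic
function on the unit disk is injective on the disk of radius 1/4. -/
theorem partial_sums_of_univalent_injective_on_quarter_disk
    (f : ℂ → ℂ) (a : ℕ → ℂ) (ha0 : a 0 = 0) (ha1 : a 1 = 1)
    (hf : ∀ z ∈ ball (0:ℂ) 1, HasSum (fun k => a k * z ^ k) (f z))
    (hinj : Set.InjOn f (ball (0:ℂ) 1))
    (n : ℕ) (hn : 2 ≤ n) :
    Set.InjOn (fun z => ∑ k ∈ Finset.range (n+1), a k * z ^ k)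
      (ball (0:ℂ) (1/4)) := by
  have hfa : taylorCoeff f = a := taylorCoeff_eq_of_hasSum hf
  obtain ⟨d, e, b, q, he0, hb0, hb1, he, hae, hd, hb, hq⟩ :=
    exists_univalent_coefficients (differentiableOn_of_hasSum hf)
      (by rw [← taylorCoeff_zero f, hfa, ha0]) (by rw [hfa, ha1]) hinj
  rw [hfa] at hae
  have he1 : e 1 = -d 1 := by simpa [he0] using he 0
  have ha2 : a 2 = -2 * d 1 := by
    rw [hae]
    simp [sum_range_succ, he0, he1]
    ring
  have ha3 : a 3 = 3 * d 1 ^ 2 - 2 * d 2 := by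
    rw [hae]
    simp only [sum_range_succ, sum_range_zero, he, he0]
    simp
    ring
  have hd2 : ‖d 1‖ ^ 2 + 3 * ‖d 2‖ ^ 2 ≤ 1 := by
    have := hd 2
    norm_num [sum_range_succ] at this
    exact this
  have hd1 : ‖d 1‖ ≤ 1 := by
    refine (abs_le_of_sq_le_sq' ?_ one_pos.le).2
    nlinarith [sq_nonneg ‖d 2‖]
  intro x hx y hy hxy
  rw [mem_ball_zero_iff] at hx hy
  simp only at hxy
  rcases (by omega : n = 2 ∨ n = 3 ∨ 4 ≤ n) with rfl | rfl | hn4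
  · simp only [sum_range_succ, sum_range_zero, ha0, ha1, ha2] at hxy
    have hfac : (x - y) * (1 - 2 * d 1 * (x + y)) = 0 := by linear_combination hxy
    refine sub_eq_zero.1 ((mul_eq_zero.1 hfac).resolve_right fun h => ?_)
    have h1 : ‖2 * d 1 * (x + y)‖ = 1 := by rw [← sub_eq_zero.1 h, norm_one]
    rw [norm_mul, norm_mul, Complex.norm_ofNat] at h1
    nlinarith [norm_add_le x y, norm_nonneg (x + y)]
  · simp only [sum_range_succ, sum_range_zero, ha0, ha1, ha2, ha3] at hxy
    have hfac : (x - y) * (1 + -2 * d 1 * (x + y) +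
        (3 * d 1 ^ 2 - 2 * d 2) * (x ^ 2 + x * y + y ^ 2)) = 0 := by linear_combination hxy
    exact sub_eq_zero.1 ((mul_eq_zero.1 hfac).resolve_right
      (cubic_divided_difference_ne_zero hd2 hx.le hy.le))
  · have hx1 : x ∈ ball (0 : ℂ) 1 := mem_ball_zero_iff.2 (hx.trans (by norm_num))
    have hy1 : y ∈ ball (0 : ℂ) 1 := mem_ball_zero_iff.2 (hy.trans (by norm_num))
    obtain ⟨hqx, hfqx⟩ := hq x hx1
    obtain ⟨hqy, hfqy⟩ := hq y hy1
    have hupper := norm_sub_le_of_sum_eq (norm_coeff_le (norm_le_pow_of_recurrence he0 he hd) hae)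
      hx.le hy.le (hf x hx1) (hf y hy1) hn4 hxy
    have hlower := norm_sub_le_norm_mul_sub_mul hb0 hb hx.le hy.le hqx hqy
    have hb1' : ‖b 1‖ ≤ 2 := by
      rw [hb1, norm_mul, Complex.norm_ofNat]
      linarith
    have hX := norm_le_of_hasSum hb0 hb hb1' hx.le hqx
    have hY := norm_le_of_hasSum hb0 hb hb1' hy.le hqy
    have hfac : x * q y - y * q x = (f x - f y) * (q x * q y) := by
      linear_combination (-q y) * hfqx + q x * hfqy
    rw [hfac, norm_mul, norm_mul] at hlower
    have hqq : ‖q x‖ * ‖q y‖ ≤ 1.565 * 1.565 :=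
      mul_le_mul hX hY (norm_nonneg _) (by norm_num)
    have hfin : 14 / 15 * ‖x - y‖ ≤ 0.36 * ‖x - y‖ * (1.565 * 1.565) :=
      hlower.trans (mul_le_mul hupper hqq (by positivity) (by positivity))
    refine sub_eq_zero.1 (norm_le_zero_iff.1 ?_)
    linarith
end

section
/- If f is a normalized analytic function on the unit disk 𝔻 that is starlike of order 1/2 (f(z) ≠ 0 and Re(z f'(z)/f(z)) > 1/2 for all 0 < |z| < 1), then for every n ≥ 2 and every z ∈ 𝔻 one has f_n(z) ≠ 0 for z ≠ 0 and Re(f(z)/f_n(z)) > 1/2 (at z = 0 the quotient is understood as its limit value 1). -/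
open Complex Metric Finset

open Real (circleAverage)
open scoped ComplexConjugate

lemma Convex.circleAverage_mul_mem {S : Set ℂ} (hS : Convex ℝ S) (hSc : IsClosed S)
    {P : ℂ → ℝ} {φ : ℂ → ℂ} {R : ℝ} (hR : 0 ≤ R) (hP : ContinuousOn P (sphere 0 R))
    (hP0 : ∀ ζ ∈ sphere (0 : ℂ) R, 0 ≤ P ζ) (hP1 : circleAverage P 0 R = 1)
    (hφ : ContinuousOn φ (sphere 0 R)) (hφS : ∀ ζ ∈ sphere (0 : ℂ) R, φ ζ ∈ S) :
    circleAverage (fun ζ ↦ (P ζ : ℂ) * φ ζ) 0 R ∈ S := by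
  by_contra hmem
  obtain ⟨ℓ, u, hu, hu'⟩ := geometric_hahn_banach_closed_point hS hSc hmem
  have hcont : ContinuousOn (fun ζ ↦ (P ζ : ℂ) * φ ζ) (sphere 0 R) :=
    (continuous_ofReal.comp_continuousOn hP).mul hφ
  have hint := hcont.circleIntegrable hR
  rw [← ℓ.circleAverage_comp_comm hint] at hu'
  have hle : circleAverage (ℓ ∘ fun ζ ↦ (P ζ : ℂ) * φ ζ) 0 R
      ≤ circleAverage (fun ζ ↦ u • P ζ) 0 R := by
    refine Real.circleAverage_mono
      ((ℓ.continuous.comp_continuousOn hcont).circleIntegrable hR)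
      ((hP.const_smul u).circleIntegrable hR) fun ζ hζ ↦ ?_
    rw [abs_of_nonneg hR] at hζ
    have : ℓ ((P ζ : ℂ) * φ ζ) = P ζ * ℓ (φ ζ) := by
      rw [← real_smul, map_smul, smul_eq_mul]
    simp only [Function.comp_apply, this, smul_eq_mul, mul_comm u]
    exact mul_le_mul_of_nonneg_left (hu _ (hφS ζ hζ)).le (hP0 ζ hζ)
  rw [Real.circleAverage_fun_smul, hP1, smul_eq_mul, mul_one] at hle
  exact absurd hu' hle.not_gt

lemma circleAverage_conj_mul_eq_zero {q κ : ℂ → ℂ} (hq : DifferentiableOn ℂ q (ball 0 1))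
    (hκ : DifferentiableOn ℂ κ (ball 0 1)) (hκ0 : κ 0 = 0)
    (hκc : ∀ u ∈ ball (0 : ℂ) 1, κ (conj u) = conj (κ u)) {R : ℝ} (hR0 : 0 < R) (hR1 : R < 1)
    {w : ℂ} (hw : ‖w‖ < R) :
    circleAverage (fun ζ ↦ conj (q ζ) * κ (w / ζ)) 0 R = 0 := by
  have hmaps : Set.MapsTo (fun ζ ↦ conj w * ζ / (R : ℂ) ^ 2) (closedBall 0 R) (ball 0 1) := by
    intro ζ hζ
    rw [mem_closedBall_zero_iff] at hζ
    rw [mem_ball_zero_iff, norm_div, norm_mul, norm_pow, norm_real, Real.norm_of_nonneg hR0.le,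
      RCLike.norm_conj, div_lt_one (by positivity)]
    nlinarith [norm_nonneg w, norm_nonneg ζ]
  have hd : DifferentiableOn ℂ (fun ζ ↦ q ζ * κ (conj w * ζ / (R : ℂ) ^ 2)) (closedBall 0 R) :=
    (hq.mono (closedBall_subset_ball hR1)).mul (hκ.comp (by fun_prop) hmaps)
  have havg : circleAverage (fun ζ ↦ q ζ * κ (conj w * ζ / (R : ℂ) ^ 2)) 0 R = 0 := by
    rw [DiffContOnCl.circleAverage, mul_zero, zero_div, hκ0, mul_zero]
    rw [abs_of_pos hR0]
    exact (hd.mono closure_ball_subset_closedBall).diffContOnCl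
  have hconj := ContinuousLinearMap.circleAverage_comp_comm (E := ℂ) (F := ℂ)
    (conjCLE : ℂ →L[ℝ] ℂ) ((hd.continuousOn.mono sphere_subset_closedBall).circleIntegrable hR0.le)
  rw [havg, map_zero] at hconj
  refine Eq.trans ?_ hconj
  refine Real.circleAverage_congr_sphere fun ζ hζ ↦ ?_
  rw [abs_of_pos hR0] at hζ
  have hζR : ‖ζ‖ = R := by simpa using hζ
  have hζ0 : ζ ≠ 0 := norm_pos_iff.1 (hζR ▸ hR0)
  have hRc : (R : ℂ) ^ 2 = ζ * conj ζ := by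
    rw [mul_conj, normSq_eq_norm_sq, hζR, ofReal_pow]
  have hζc : conj ζ ≠ 0 := by simpa using hζ0
  have : w / ζ = conj (conj w * ζ / (R : ℂ) ^ 2) := by
    simp only [map_div₀, map_mul, conj_conj, map_pow, conj_ofReal]
    rw [hRc]; field_simp
  have hκζ := hκc _ (hmaps (sphere_subset_closedBall hζ))
  beta_reduce at hκζ
  rw [this, hκζ]
  simp

lemma circleAverage_re_mul {q κ : ℂ → ℂ} (hq : DifferentiableOn ℂ q (ball 0 1))
    (hκ : DifferentiableOn ℂ κ (ball 0 1)) (hκ0 : κ 0 = 0)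
    (hκc : ∀ u ∈ ball (0 : ℂ) 1, κ (conj u) = conj (κ u)) {R : ℝ} (hR0 : 0 < R) (hR1 : R < 1)
    {w : ℂ} (hw : ‖w‖ < R) :
    circleAverage (fun ζ ↦ ((2 * (q ζ).re - 1 : ℝ) : ℂ) * κ (w / ζ)) 0 R
      = circleAverage (fun ζ ↦ (q ζ - 1) * κ (w / ζ)) 0 R := by
  have hsub : sphere (0 : ℂ) R ⊆ ball 0 1 := sphere_subset_closedBall.trans
    (closedBall_subset_ball hR1)
  have hqc : ContinuousOn q (sphere 0 R) := hq.continuousOn.mono hsub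
  have hκcont : ContinuousOn (fun ζ ↦ κ (w / ζ)) (sphere 0 R) := by
    refine hκ.continuousOn.comp (continuousOn_const.div continuousOn_id fun ζ hζ ↦ ?_)
      fun ζ hζ ↦ ?_
    · exact ne_of_mem_sphere hζ hR0.ne'
    · have : ‖ζ‖ = R := by simpa using hζ
      rwa [mem_ball_zero_iff, norm_div, this, div_lt_one hR0]
  have hzero := circleAverage_conj_mul_eq_zero hq hκ hκ0 hκc hR0 hR1 hw
  have hadd := Real.circleAverage_fun_add (c := 0) (R := R)
    (f₁ := fun ζ ↦ (q ζ - 1) * κ (w / ζ)) (f₂ := fun ζ ↦ conj (q ζ) * κ (w / ζ))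
    (((hqc.sub continuousOn_const).mul hκcont).circleIntegrable hR0.le)
    (((continuous_conj.comp_continuousOn hqc).mul hκcont).circleIntegrable hR0.le)
  rw [hzero, add_zero] at hadd
  rw [← hadd]
  congr 1
  ext ζ
  have h2 : ((2 * (q ζ).re - 1 : ℝ) : ℂ) = q ζ - 1 + conj (q ζ) := by
    rw [sub_add_eq_add_sub, add_conj]; push_cast; ring
  rw [h2, add_mul]

lemma circleAverage_two_re_sub_one {q : ℂ → ℂ} (hq : DifferentiableOn ℂ q (ball 0 1))
    (hq0 : q 0 = 1) {R : ℝ} (hR0 : 0 < R) (hR1 : R < 1) :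
    circleAverage (fun ζ ↦ 2 * (q ζ).re - 1) 0 R = 1 := by
  have hd : DifferentiableOn ℂ (fun ζ ↦ 2 * q ζ - 1) (closedBall 0 R) :=
    ((hq.mono (closedBall_subset_ball hR1)).const_mul 2).sub_const 1
  have havg : circleAverage (fun ζ ↦ 2 * q ζ - 1) 0 R = 1 := by
    rw [DiffContOnCl.circleAverage, hq0]
    · norm_num
    rw [abs_of_pos hR0]
    exact (hd.mono closure_ball_subset_closedBall).diffContOnCl
  have hre := reCLM.circleAverage_comp_comm
    ((hd.continuousOn.mono sphere_subset_closedBall).circleIntegrable hR0.le)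
  rw [havg] at hre
  simpa [Function.comp_def] using hre

lemma hasFPowerSeriesOnBall_ofScalars_of_hasSum {c : ℕ → ℂ} {w : ℂ → ℂ}
    (hw : ∀ t ∈ ball (0 : ℂ) 1, HasSum (fun k ↦ c k * t ^ k) (w t)) :
    HasFPowerSeriesOnBall w (.ofScalars ℂ c) 0 1 where
  r_le := by
    refine ENNReal.le_of_forall_nnreal_lt fun r hr ↦ ?_
    have hr1 : (r : ℝ) < 1 := by exact_mod_cast hr
    refine FormalMultilinearSeries.le_radius_of_summable _ ?_
    have := (hw (r : ℝ) (by simpa using hr1)).summable.norm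
    simpa [FormalMultilinearSeries.ofScalars_norm] using this
  r_pos := one_pos
  hasSum := by
    intro y hy
    have hy' : y ∈ ball (0 : ℂ) 1 := by rwa [← ENNReal.ofReal_one, Metric.eball_ofReal] at hy
    simpa [FormalMultilinearSeries.ofScalars_apply_eq, mul_comm] using hw y hy'

lemma differentiableOn_of_hasSum_mul_pow {c : ℕ → ℂ} {w : ℂ → ℂ}
    (hw : ∀ t ∈ ball (0 : ℂ) 1, HasSum (fun k ↦ c k * t ^ k) (w t)) :
    DifferentiableOn ℂ w (ball 0 1) := by
  have := (hasFPowerSeriesOnBall_ofScalars_of_hasSum hw).differentiableOn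
  rwa [← ENNReal.ofReal_one, Metric.eball_ofReal] at this

/-- The Carathéodory coefficient bound. -/
lemma norm_coeff_le_one_of_half_le_re {c : ℕ → ℂ} {w : ℂ → ℂ}
    (hw : ∀ t ∈ ball (0 : ℂ) 1, HasSum (fun k ↦ c k * t ^ k) (w t)) (hc0 : c 0 = 1)
    (hre : ∀ t ∈ ball (0 : ℂ) 1, 1 / 2 ≤ (w t).re) {n : ℕ} (hn : n ≠ 0) : ‖c n‖ ≤ 1 := by
  have hd := differentiableOn_of_hasSum_mul_pow hw
  have hw0 : w 0 = 1 := by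
    have h := (hw 0 (by simp)).unique (hasSum_single 0 fun k hk ↦ by simp [hk])
    simpa [hc0] using h
  have key : ∀ R : ℝ, 0 < R → R < 1 → ‖c n‖ * R ^ n ≤ 1 := by
    intro R hR0 hR1
    lift R to NNReal using hR0.le
    have hRpos : 0 < R := by exact_mod_cast hR0
    have hsub := (closedBall_subset_ball (x := (0 : ℂ)) hR1)
    have hcoeff : c n = (2 * Real.pi * I : ℂ)⁻¹ • ∮ z in C(0, R), (1 / (z - 0)) ^ n •
        (z - 0)⁻¹ • w z := by
      rw [← cauchyPowerSeries_apply,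
        ← (hasFPowerSeriesOnBall_ofScalars_of_hasSum hw).hasFPowerSeriesAt.eq_formalMultilinearSeries
          ((hd.mono hsub).hasFPowerSeriesOnBall hRpos).hasFPowerSeriesAt]
      simp
    have hr : ‖((R / 2 : ℝ) : ℂ)‖ < R := by
      rw [norm_real, Real.norm_of_nonneg (by positivity)]; linarith
    have hζ0 : ∀ ζ ∈ sphere (0 : ℂ) R, ζ ≠ 0 := fun ζ hζ ↦ ne_of_mem_sphere hζ hR0.ne'
    have hwc : ContinuousOn w (sphere 0 R) :=
      hd.continuousOn.mono (sphere_subset_closedBall.trans hsub)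
    have hpow : ContinuousOn (fun ζ : ℂ ↦ (((R / 2 : ℝ) : ℂ) / ζ) ^ n) (sphere 0 R) :=
      (continuousOn_const.div continuousOn_id hζ0).pow n
    have hmean : circleAverage (fun ζ ↦ ((2 * (w ζ).re - 1 : ℝ) : ℂ)
        * (((R / 2 : ℝ) : ℂ) / ζ) ^ n) 0 R = c n * ((R / 2 : ℝ) : ℂ) ^ n := by
      rw [circleAverage_re_mul (κ := fun u ↦ u ^ n) hd (by fun_prop) (by simp [hn])
        (by simp) hR0 hR1 hr]
      have hzero := circleAverage_conj_mul_eq_zero (q := fun _ ↦ 1) (κ := fun u ↦ u ^ n)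
        (by fun_prop) (by fun_prop) (by simp [hn]) (by simp) hR0 hR1 hr
      simp only [map_one, one_mul] at hzero
      simp_rw [sub_mul, one_mul]
      rw [Real.circleAverage_fun_sub (f₁ := fun ζ ↦ w ζ * (((R / 2 : ℝ) : ℂ) / ζ) ^ n)
        ((hwc.mul hpow).circleIntegrable hR0.le)
        (hpow.circleIntegrable hR0.le), hzero, sub_zero, hcoeff,
        Real.circleAverage_eq_circleIntegral hR0.ne', smul_eq_mul, smul_eq_mul,
        mul_assoc (2 * Real.pi * I : ℂ)⁻¹]
      congr 1
      rw [mul_comm _ (((R / 2 : ℝ) : ℂ) ^ n), ← smul_eq_mul, ← circleIntegral.integral_smul]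
      refine circleIntegral.integral_congr hR0.le fun ζ _ ↦ ?_
      simp only [smul_eq_mul, div_pow, one_div, inv_pow, sub_zero]
      ring
    have hmem := (convex_closedBall (0 : ℂ) ((1 / 2 : ℝ) ^ n)).circleAverage_mul_mem
      isClosed_closedBall hR0.le (P := fun ζ ↦ 2 * (w ζ).re - 1)
      (φ := fun ζ ↦ (((R / 2 : ℝ) : ℂ) / ζ) ^ n)
      (((continuous_re.comp_continuousOn hwc).const_mul 2).sub continuousOn_const)
      (fun ζ hζ ↦ by linarith [hre ζ (hsub (sphere_subset_closedBall hζ))])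
      (circleAverage_two_re_sub_one hd hw0 hR0 hR1) hpow fun ζ hζ ↦ by
        have hζR : ‖ζ‖ = R := by simpa using hζ
        rw [mem_closedBall_zero_iff, norm_pow, norm_div, hζR, norm_real,
          Real.norm_of_nonneg (by positivity), div_right_comm, div_self hR0.ne']
    rw [hmean, mem_closedBall_zero_iff, norm_mul, norm_pow, norm_real,
      Real.norm_of_nonneg (by positivity), div_pow, one_div, inv_pow, div_eq_mul_inv, ← mul_assoc]
      at hmem
    exact (mul_le_iff_le_one_left (by positivity)).1 hmem
  have ht : Filter.Tendsto (fun R : ℝ ↦ ‖c n‖ * R ^ n) (nhdsWithin 1 (Set.Iio 1))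
      (nhds (‖c n‖ * 1 ^ n)) :=
    ((continuous_const.mul (continuous_pow n)).tendsto 1).mono_left nhdsWithin_le_nhds
  rw [one_pow, mul_one] at ht
  refine le_of_tendsto ht ?_
  filter_upwards [Ioo_mem_nhdsLT (zero_lt_one (α := ℝ))] with R hR using key R hR.1 hR.2

lemma one_sub_mem_slitPlane {u : ℂ} (hu : ‖u‖ < 1) : 1 - u ∈ slitPlane := by
  left
  have := (abs_le.1 (abs_re_le_norm u)).2
  simp only [sub_re, one_re]
  linarith

/-- Herglotz representation of a primitive. -/
lemma circleAverage_re_mul_neg_log {F F' : ℂ → ℂ}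
    (hF : ∀ ζ ∈ ball (0 : ℂ) 1, HasDerivAt F (F' ζ) ζ) (hF' : DifferentiableOn ℂ F' (ball 0 1))
    {R : ℝ} (hR0 : 0 < R) (hR1 : R < 1) {w : ℂ} (hw : ‖w‖ < R) :
    circleAverage (fun ζ ↦ ((2 * (1 + ζ * F' ζ).re - 1 : ℝ) : ℂ) * -log (1 - w / ζ)) 0 R
      = F w - F 0 := by
  have hFd : DifferentiableOn ℂ F (ball 0 1) := fun ζ hζ ↦
    (hF ζ hζ).differentiableAt.differentiableWithinAt
  have hsub := closedBall_subset_ball (x := (0 : ℂ)) hR1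
  have hFc : DiffContOnCl ℂ F (ball 0 |R|) := by
    rw [abs_of_pos hR0]
    exact ((hFd.mono hsub).mono closure_ball_subset_closedBall).diffContOnCl
  have hζ0 : ∀ ζ ∈ sphere (0 : ℂ) R, ζ ≠ 0 := fun ζ hζ ↦ ne_of_mem_sphere hζ hR0.ne'
  have hζw : ∀ ζ ∈ sphere (0 : ℂ) R, ζ - w ≠ 0 := by
    intro ζ hζ h
    rw [sub_eq_zero] at h
    rw [mem_sphere_zero_iff_norm, h] at hζ
    exact hw.ne hζ
  have hu : ∀ ζ ∈ sphere (0 : ℂ) R, ‖w / ζ‖ < 1 := by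
    intro ζ hζ
    rw [mem_sphere_zero_iff_norm] at hζ
    rwa [norm_div, hζ, div_lt_one hR0]
  have hFcont : ContinuousOn F (sphere 0 R) :=
    hFd.continuousOn.mono (sphere_subset_closedBall.trans hsub)
  have hF'cont : ContinuousOn F' (sphere 0 R) :=
    hF'.continuousOn.mono (sphere_subset_closedBall.trans hsub)
  have hlog : ContinuousOn (fun ζ ↦ -log (1 - w / ζ)) (sphere 0 R) :=
    ((continuousOn_const.sub (continuousOn_const.div continuousOn_id hζ0)).clog
      fun ζ hζ ↦ one_sub_mem_slitPlane (hu ζ hζ)).neg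
  rw [circleAverage_re_mul (q := fun ζ ↦ 1 + ζ * F' ζ) (κ := fun u ↦ -log (1 - u)) (by fun_prop)
    (fun u hu ↦ ?_) (by simp) (fun u hu ↦ ?_) hR0 hR1 hw]
  · have hint1 : CircleIntegrable (fun ζ ↦ (1 + ζ * F' ζ - 1) * -log (1 - w / ζ)) 0 R :=
      (((continuousOn_const.add (continuousOn_id.mul hF'cont)).sub continuousOn_const).mul
        hlog).circleIntegrable hR0.le
    have hint2 : CircleIntegrable (fun ζ ↦ (ζ - 0) / (ζ - w) * F ζ) 0 R :=
      (((continuousOn_id.sub continuousOn_const).div (continuousOn_id.sub continuousOn_const)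
        hζw).mul hFcont).circleIntegrable hR0.le
    have hint3 : CircleIntegrable F 0 R := hFcont.circleIntegrable hR0.le
    have hzero : circleAverage (fun ζ ↦ (1 + ζ * F' ζ - 1) * -log (1 - w / ζ) -
        ((ζ - 0) / (ζ - w) * F ζ - F ζ)) 0 R = 0 := by
      rw [Real.circleAverage_eq_circleIntegral hR0.ne',
        circleIntegral.integral_eq_zero_of_hasDerivWithinAt
          (f := fun ζ ↦ F ζ * -log (1 - w / ζ)) hR0.le, smul_zero]
      intro ζ hζ
      have hz := hζ0 ζ hζ
      have hzw := hζw ζ hζ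
      have h1 : HasDerivAt (fun ζ ↦ 1 - w / ζ) (w / ζ ^ 2) ζ := by
        simp only [div_eq_mul_inv]
        exact (((hasDerivAt_inv hz).const_mul w).const_sub 1).congr_deriv (by simp)
      have h2 := (hF ζ (hsub (sphere_subset_closedBall hζ))).mul
        (h1.clog (one_sub_mem_slitPlane (hu ζ hζ))).neg
      refine (h2.congr_deriv ?_).hasDerivWithinAt
      have h3 : 1 - w / ζ = (ζ - w) / ζ := by field_simp
      simp only [Pi.neg_apply, h3, smul_eq_mul]
      field_simp
      ring
    rw [Real.circleAverage_fun_sub (f₁ := fun ζ ↦ (1 + ζ * F' ζ - 1) * -log (1 - w / ζ))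
        (f₂ := fun ζ ↦ (ζ - 0) / (ζ - w) * F ζ - F ζ) hint1 (hint2.sub hint3),
      Real.circleAverage_fun_sub (f₁ := fun ζ ↦ (ζ - 0) / (ζ - w) * F ζ) hint2 hint3,
      sub_eq_zero] at hzero
    rw [hzero, hFc.circleAverage]
    congr 1
    exact hFc.circleAverage_smul_div (by rwa [abs_of_pos hR0, mem_ball_zero_iff])
  · rw [mem_ball_zero_iff] at hu
    exact (((differentiableAt_const 1).sub differentiableAt_id).clog
      (one_sub_mem_slitPlane hu)).neg.differentiableWithinAt
  · rw [mem_ball_zero_iff] at hu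
    have := log_conj (1 - u) (slitPlane_arg_ne_pi (one_sub_mem_slitPlane hu))
    rw [map_sub, map_one] at this
    rw [this, map_neg]

lemma convex_setOf_le_re_exp {d : ℝ} (hd : 0 < d) :
    Convex ℝ {G : ℂ | |G.im| ≤ Real.pi / 2 ∧ d ≤ (exp G).re} := by
  rintro x ⟨hx1, hx2⟩ y ⟨hy1, hy2⟩ a b ha hb hab
  rw [abs_le] at hx1 hy1
  rw [exp_re] at hx2 hy2
  have hxm : x.im ∈ Set.Icc (-(Real.pi / 2)) (Real.pi / 2) := hx1
  have hym : y.im ∈ Set.Icc (-(Real.pi / 2)) (Real.pi / 2) := hy1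
  have hcx := Real.cos_nonneg_of_mem_Icc hxm
  have hcy := Real.cos_nonneg_of_mem_Icc hym
  refine ⟨abs_le.2 ?_, ?_⟩
  · simpa using (convex_Icc _ _) hxm hym ha hb hab
  have hcos : a * Real.cos x.im + b * Real.cos y.im ≤ Real.cos (a * x.im + b * y.im) := by
    simpa using strictConcaveOn_cos_Icc.concaveOn.2 hxm hym ha hb hab
  have hre : (exp (a • x + b • y)).re
      = Real.exp x.re ^ a * Real.exp y.re ^ b * Real.cos (a * x.im + b * y.im) := by
    rw [exp_re, ← Real.exp_mul, ← Real.exp_mul, ← Real.exp_add]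
    simp [mul_comm]
  rw [hre]
  calc d = d ^ a * d ^ b := by rw [← Real.rpow_add hd, hab, Real.rpow_one]
    _ ≤ (Real.exp x.re * Real.cos x.im) ^ a * (Real.exp y.re * Real.cos y.im) ^ b := by gcongr
    _ = Real.exp x.re ^ a * Real.exp y.re ^ b * (Real.cos x.im ^ a * Real.cos y.im ^ b) := by
      rw [Real.mul_rpow (Real.exp_nonneg _) hcx, Real.mul_rpow (Real.exp_nonneg _) hcy]
      ring
    _ ≤ Real.exp x.re ^ a * Real.exp y.re ^ b * (a * Real.cos x.im + b * Real.cos y.im) := by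
      gcongr
      exact Real.geom_mean_le_arith_mean2_weighted ha hb hcx hcy hab
    _ ≤ _ := by gcongr

lemma isClosed_setOf_le_re_exp (d : ℝ) :
    IsClosed {G : ℂ | |G.im| ≤ Real.pi / 2 ∧ d ≤ (exp G).re} :=
  (isClosed_le (continuous_abs.comp continuous_im) continuous_const).inter
    (isClosed_le continuous_const (continuous_re.comp continuous_exp))

lemma norm_sub_one_le_norm_sub_iff {v t : ℂ} :
    ‖v - 1‖ ≤ ‖v - t‖ ↔ (1 - ‖t‖ ^ 2) / 2 ≤ (v * (1 - conj t)).re := by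
  rw [← sq_le_sq₀ (norm_nonneg _) (norm_nonneg _), ← normSq_eq_norm_sq, ← normSq_eq_norm_sq,
    ← normSq_eq_norm_sq, normSq_apply, normSq_apply, normSq_apply]
  simp only [sub_re, sub_im, one_re, one_im, mul_re, conj_re, conj_im]
  constructor <;> intro h <;> linarith

lemma abs_im_log_lt {u : ℂ} (hu : ‖u‖ < 1) : |(log (1 - u)).im| < Real.pi / 2 := by
  rw [log_im, abs_arg_lt_pi_div_two_iff]
  left
  have := (abs_le.1 (abs_re_le_norm u)).2
  simp only [sub_re, one_re]
  linarith

lemma log_ratio_mem {t u : ℂ} (ht : ‖t‖ < 1) (hu : ‖u‖ < 1) :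
    -log (1 - u) - -log (1 - t * u) + log (1 - conj t) ∈
      {G : ℂ | |G.im| ≤ Real.pi / 2 ∧ (1 - ‖t‖ ^ 2) / 2 ≤ (exp G).re} := by
  have htu : ‖t * u‖ < 1 := by
    rw [norm_mul]; exact mul_lt_one_of_nonneg_of_lt_one_left (norm_nonneg _) ht hu.le
  have htc : ‖conj t‖ < 1 := by rwa [RCLike.norm_conj]
  have h1 := slitPlane_ne_zero (one_sub_mem_slitPlane hu)
  have hexp : exp (-log (1 - u) - -log (1 - t * u) + log (1 - conj t))
      = (1 - t * u) / (1 - u) * (1 - conj t) := by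
    rw [exp_add, exp_sub, exp_neg, exp_neg, exp_log h1,
      exp_log (slitPlane_ne_zero (one_sub_mem_slitPlane htu)),
      exp_log (slitPlane_ne_zero (one_sub_mem_slitPlane htc))]
    field_simp
  have hre : (1 - ‖t‖ ^ 2) / 2 ≤ (exp (-log (1 - u) - -log (1 - t * u) + log (1 - conj t))).re := by
    rw [hexp, ← norm_sub_one_le_norm_sub_iff]
    have e1 : (1 - t * u) / (1 - u) - 1 = u * ((1 - t) / (1 - u)) := by field_simp; ring
    have e2 : (1 - t * u) / (1 - u) - t = (1 - t) / (1 - u) := by field_simp; ring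
    rw [e1, e2, norm_mul]
    exact mul_le_of_le_one_left (norm_nonneg _) hu.le
  refine ⟨?_, hre⟩
  have hpos : 0 < (exp (-log (1 - u) - -log (1 - t * u) + log (1 - conj t))).re := by
    refine lt_of_lt_of_le ?_ hre
    nlinarith [norm_nonneg t]
  rw [exp_re, mul_pos_iff_of_pos_left (Real.exp_pos _), ← Real.cos_abs] at hpos
  by_contra! hlt
  refine hpos.not_ge (Real.cos_nonpos_of_pi_div_two_le_of_le hlt.le ?_)
  have b1 := abs_lt.1 (abs_im_log_lt hu)
  have b2 := abs_lt.1 (abs_im_log_lt htu)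
  have b3 := abs_lt.1 (abs_im_log_lt htc)
  simp only [add_im, sub_im, neg_im]
  rw [abs_le]
  constructor <;> linarith [b1.1, b1.2, b2.1, b2.2, b3.1, b3.2]

lemma exists_hasDerivAt_logDeriv_and_exp_eq {g : ℂ → ℂ} (hg : DifferentiableOn ℂ g (ball 0 1))
    (hg0 : ∀ z ∈ ball (0 : ℂ) 1, g z ≠ 0) (hg1 : g 0 = 1) :
    ∃ F : ℂ → ℂ, F 0 = 0 ∧ ∀ z ∈ ball (0 : ℂ) 1,
      HasDerivAt F (deriv g z / g z) z ∧ exp (F z) = g z := by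
  have hd : DifferentiableOn ℂ (fun z ↦ deriv g z / g z) (ball 0 1) :=
    (hg.deriv isOpen_ball).div hg hg0
  obtain ⟨F, hF0, hF⟩ := hd.isExactOn_ball.with_val_at 0 0
  refine ⟨F, hF0, fun z hz ↦ ⟨hF z hz, ?_⟩⟩
  have hder : ∀ x ∈ ball (0 : ℂ) 1, HasDerivAt (fun x ↦ exp (-F x) * g x) 0 x := by
    intro x hx
    have hgx := (hg.differentiableAt (isOpen_ball.mem_nhds hx)).hasDerivAt
    refine ((hF x hx).neg.cexp.mul hgx).congr_deriv ?_
    have := hg0 x hx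
    simp only [Pi.neg_apply]
    field_simp
    ring
  have hconst := isOpen_ball.is_const_of_deriv_eq_zero (convex_ball (0 : ℂ) 1).isPreconnected
    (fun x hx ↦ (hder x hx).differentiableAt.differentiableWithinAt)
    (fun x hx ↦ (hder x hx).deriv) hz (mem_ball_self one_pos)
  simp only [hF0, hg1, neg_zero, exp_zero, mul_one] at hconst
  rw [exp_neg, inv_mul_eq_one₀ (exp_ne_zero _)] at hconst
  exact hconst

lemma norm_div_sub_one_le_norm_div_sub {g : ℂ → ℂ} (hg : DifferentiableOn ℂ g (ball 0 1))
    (hg0 : ∀ z ∈ ball (0 : ℂ) 1, g z ≠ 0) (hg1 : g 0 = 1)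
    (hre : ∀ z ∈ ball (0 : ℂ) 1, 1 / 2 ≤ (1 + z * (deriv g z / g z)).re) {z t : ℂ}
    (hz : ‖z‖ < 1) (ht : ‖t‖ < 1) :
    ‖g z / g (t * z) - 1‖ ≤ ‖g z / g (t * z) - t‖ := by
  obtain ⟨F, hF0, hF⟩ := exists_hasDerivAt_logDeriv_and_exp_eq hg hg0 hg1
  have hF' : DifferentiableOn ℂ (fun z ↦ deriv g z / g z) (ball 0 1) :=
    (hg.deriv isOpen_ball).div hg hg0
  have hq : DifferentiableOn ℂ (fun z ↦ 1 + z * (deriv g z / g z)) (ball 0 1) := by fun_prop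
  obtain ⟨R, hzR, hR1⟩ := exists_between hz
  have hR0 : 0 < R := (norm_nonneg z).trans_lt hzR
  have htz : ‖t * z‖ ≤ ‖z‖ := by
    rw [norm_mul]; exact mul_le_of_le_one_left (norm_nonneg _) ht.le
  have hsub := closedBall_subset_ball (x := (0 : ℂ)) hR1
  have hPc : ContinuousOn (fun ζ ↦ 2 * (1 + ζ * (deriv g ζ / g ζ)).re - 1) (sphere 0 R) :=
    ((continuous_re.comp_continuousOn (hq.continuousOn.mono
      (sphere_subset_closedBall.trans hsub))).const_mul 2).sub continuousOn_const
  have hnorm : ∀ ζ ∈ sphere (0 : ℂ) R, ∀ w : ℂ, ‖w‖ < R → ‖w / ζ‖ < 1 := by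
    intro ζ hζ w hw
    rw [mem_sphere_zero_iff_norm] at hζ
    rwa [norm_div, hζ, div_lt_one hR0]
  have hlogc : ∀ w : ℂ, ‖w‖ < R → ContinuousOn (fun ζ ↦ -log (1 - w / ζ)) (sphere 0 R) :=
    fun w hw ↦ ((continuousOn_const.sub (continuousOn_const.div continuousOn_id
      fun ζ hζ ↦ ne_of_mem_sphere hζ hR0.ne')).clog
        fun ζ hζ ↦ one_sub_mem_slitPlane (hnorm ζ hζ w hw)).neg
  have hd : 0 < (1 - ‖t‖ ^ 2) / 2 := by nlinarith [norm_nonneg t]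
  have hz1 := hlogc z hzR
  have hz2 := hlogc (t * z) (htz.trans_lt hzR)
  have hmem := ((convex_setOf_le_re_exp hd).translate_preimage_left
    (log (1 - conj t))).circleAverage_mul_mem
    ((isClosed_setOf_le_re_exp _).preimage (continuous_id.add continuous_const)) hR0.le hPc
    (fun ζ hζ ↦ by linarith [hre ζ (hsub (sphere_subset_closedBall hζ))])
    (circleAverage_two_re_sub_one hq (by simp) hR0 hR1)
    (hz1.sub hz2) fun ζ hζ ↦ by
      have := log_ratio_mem ht (hnorm ζ hζ z hzR)
      rwa [← mul_div_assoc] at this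
  have havg : circleAverage (fun ζ ↦ ((2 * (1 + ζ * (deriv g ζ / g ζ)).re - 1 : ℝ) : ℂ) *
      (-log (1 - z / ζ) - -log (1 - t * z / ζ))) 0 R = F z - F (t * z) := by
    have hPc' := continuous_ofReal.comp_continuousOn hPc
    simp_rw [mul_sub]
    rw [Real.circleAverage_fun_sub
      (f₁ := fun ζ ↦ ((2 * (1 + ζ * (deriv g ζ / g ζ)).re - 1 : ℝ) : ℂ) * -log (1 - z / ζ))
      (f₂ := fun ζ ↦ ((2 * (1 + ζ * (deriv g ζ / g ζ)).re - 1 : ℝ) : ℂ) * -log (1 - t * z / ζ))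
      ((hPc'.mul hz1).circleIntegrable hR0.le)
      ((hPc'.mul hz2).circleIntegrable hR0.le)]
    have h1 := circleAverage_re_mul_neg_log (fun ζ hζ ↦ (hF ζ hζ).1) hF' hR0 hR1 hzR
    have h2 := circleAverage_re_mul_neg_log (fun ζ hζ ↦ (hF ζ hζ).1) hF' hR0 hR1
      (htz.trans_lt hzR)
    exact (congrArg₂ (· - ·) h1 h2).trans (sub_sub_sub_cancel_right _ _ _)
  have hmem' : F z - F (t * z) + log (1 - conj t) ∈
      {G : ℂ | |G.im| ≤ Real.pi / 2 ∧ (1 - ‖t‖ ^ 2) / 2 ≤ (exp G).re} := by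
    rw [← havg]; exact hmem
  have hlast := hmem'.2
  rw [exp_add, exp_sub, (hF z (by simpa using hz)).2,
    (hF (t * z) (by simpa using htz.trans_lt hz)).2,
    exp_log (slitPlane_ne_zero (one_sub_mem_slitPlane (by rwa [RCLike.norm_conj])))] at hlast
  exact norm_sub_one_le_norm_sub_iff.2 hlast

lemma half_le_re_one_sub_div_div {g : ℂ → ℂ} (hg : DifferentiableOn ℂ g (ball 0 1))
    (hg0 : ∀ z ∈ ball (0 : ℂ) 1, g z ≠ 0) (hg1 : g 0 = 1)
    (hre : ∀ z ∈ ball (0 : ℂ) 1, 1 / 2 ≤ (1 + z * (deriv g z / g z)).re) {z t : ℂ}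
    (hz : ‖z‖ < 1) (ht : ‖t‖ < 1) :
    1 / 2 ≤ ((1 - t * g (t * z) / g z) / (1 - t)).re := by
  have hv := norm_div_sub_one_le_norm_div_sub hg hg0 hg1 hre hz ht
  have ht1 : 1 - t ≠ 0 := slitPlane_ne_zero (one_sub_mem_slitPlane ht)
  have hgz := hg0 z (by simpa using hz)
  have hgtz := hg0 (t * z) (by
    rw [mem_ball_zero_iff, norm_mul]
    exact mul_lt_one_of_nonneg_of_lt_one_left (norm_nonneg _) ht hz.le)
  set A := g z
  set B := g (t * z)
  have hle : ‖(1 - t * B / A) / (1 - t) - 1‖ ≤ ‖(1 - t * B / A) / (1 - t) - 0‖ := by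
    have e1 : (1 - t * B / A) / (1 - t) - 1 = B / A / (1 - t) * (t * (A / B - 1)) := by
      field_simp; ring
    have e2 : (1 - t * B / A) / (1 - t) = B / A / (1 - t) * (A / B - t) := by
      field_simp
    rw [sub_zero, e1, e2, norm_mul, norm_mul _ (A / B - t), norm_mul t]
    gcongr
    exact (mul_le_of_le_one_left (norm_nonneg _) ht.le).trans hv
  have := norm_sub_one_le_norm_sub_iff.1 hle
  simpa using this

lemma hasSum_sum_range_mul_pow {b : ℕ → ℂ} {s t : ℂ} (ht : ‖t‖ < 1)
    (hb : HasSum (fun k ↦ b k * t ^ k) s) :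
    HasSum (fun k ↦ (∑ i ∈ range (k + 1), b i) * t ^ k) (s / (1 - t)) := by
  have hgeom := hasSum_geometric_of_norm_lt_one ht
  have h := hasSum_sum_range_mul_of_summable_norm hb.summable.norm hgeom.summable.norm
  rw [hb.tsum_eq, hgeom.tsum_eq, ← div_eq_mul_inv] at h
  refine h.congr_fun fun k ↦ ?_
  rw [sum_mul]
  refine sum_congr rfl fun i hi ↦ ?_
  rw [mul_assoc, ← pow_add, Nat.add_sub_cancel' (Nat.lt_succ_iff.1 (mem_range.1 hi))]

lemma half_lt_re_inv_of_norm_one_sub_lt_one {u : ℂ} (hu : ‖1 - u‖ < 1) : 1 / 2 < (u⁻¹).re := by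
  have hu0 : u ≠ 0 := by
    rintro rfl
    simp at hu
  rw [inv_re, lt_div_iff₀ (normSq_pos.2 hu0)]
  rw [← sq_lt_one_iff₀ (norm_nonneg _), ← normSq_eq_norm_sq, normSq_sub, map_one, one_mul,
    conj_re] at hu
  linarith

/-- For a normalized analytic function f starlike of order 1/2 on the unit disk,
every partial sum f_n (n ≥ 2) satisfies f_n(z) ≠ 0 and Re(f(z)/f_n(z)) > 1/2 for
0 < |z| < 1. -/
theorem re_quotient_partial_sum_of_starlike_order_half
    (f : ℂ → ℂ) (a : ℕ → ℂ) (ha0 : a 0 = 0) (ha1 : a 1 = 1)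
    (hf : ∀ z ∈ ball (0:ℂ) 1, HasSum (fun k => a k * z ^ k) (f z))
    (hstar : ∀ z ∈ ball (0:ℂ) 1, z ≠ 0 →
      f z ≠ 0 ∧ 1/2 < (z * deriv f z / f z).re)
    (n : ℕ) (hn : 2 ≤ n) :
    ∀ z ∈ ball (0:ℂ) 1, z ≠ 0 →
      (∑ k ∈ Finset.range (n+1), a k * z ^ k) ≠ 0 ∧
      1/2 < (f z / ∑ k ∈ Finset.range (n+1), a k * z ^ k).re := by
  set g : ℂ → ℂ := Function.update (fun z ↦ f z / z) 0 1
  have hg1 : g 0 = 1 := Function.update_self ..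
  have hgz : ∀ z, z ≠ 0 → g z = f z / z := fun z hz ↦ Function.update_of_ne hz ..
  have hgsum : ∀ z ∈ ball (0 : ℂ) 1, HasSum (fun k ↦ a (k + 1) * z ^ k) (g z) := by
    intro z hz
    rcases eq_or_ne z 0 with rfl | hz0
    · have := hasSum_single (f := fun k ↦ a (k + 1) * (0 : ℂ) ^ k) 0 fun k hk ↦ by simp [hk]
      simpa [hg1, ha1] using this
    · have h := ((hasSum_nat_add_iff' 1).2 (hf z hz)).div_const z
      rw [hgz z hz0]
      simpa [ha0, pow_succ, hz0, ← mul_assoc] using h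
  have hg := differentiableOn_of_hasSum_mul_pow hgsum
  have hg0 : ∀ z ∈ ball (0 : ℂ) 1, g z ≠ 0 := by
    intro z hz
    rcases eq_or_ne z 0 with rfl | hz0
    · simp [hg1]
    · rw [hgz z hz0]
      exact div_ne_zero (hstar z hz hz0).1 hz0
  have hfg : ∀ z, z ≠ 0 → f z = z * g z := fun z hz0 ↦ by
    rw [hgz z hz0, mul_div_cancel₀ _ hz0]
  have hre : ∀ z ∈ ball (0 : ℂ) 1, 1 / 2 ≤ (1 + z * (deriv g z / g z)).re := by
    intro z hz
    rcases eq_or_ne z 0 with rfl | hz0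
    · norm_num
    have hder : deriv f z = g z + z * deriv g z := by
      have hgd := (hg.differentiableAt (isOpen_ball.mem_nhds hz)).hasDerivAt
      have hd := (hasDerivAt_id z).mul hgd
      have heq : f =ᶠ[nhds z] id * g := by
        filter_upwards [isOpen_ne.mem_nhds hz0] with x hx using hfg x hx
      rw [heq.deriv_eq, hd.deriv]
      simp
    have h := (hstar z hz hz0).2.le
    have hne := hg0 z hz
    have he : z * deriv f z / f z = 1 + z * (deriv g z / g z) := by
      rw [hder, hfg z hz0]
      field_simp
    rwa [he] at h
  have hcoeff : ∀ z ∈ ball (0 : ℂ) 1, z ≠ 0 →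
      ‖1 - (∑ k ∈ range (n + 1), a k * z ^ k) / f z‖ ≤ 1 := by
    intro z hz hz0
    have hz1 : ‖z‖ < 1 := by simpa using hz
    have hfz := (hstar z hz hz0).1
    refine norm_coeff_le_one_of_half_le_re
      (c := fun m ↦ 1 - (∑ k ∈ range (m + 1), a k * z ^ k) / f z)
      (w := fun t ↦ (1 - t * g (t * z) / g z) / (1 - t)) (fun t ht ↦ ?_) (by simp [ha0])
      (fun t ht ↦ half_le_re_one_sub_div_div hg hg0 hg1 hre hz1 (by simpa using ht)) (by lia)
    have ht1 : ‖t‖ < 1 := by simpa using ht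
    have htz : t * z ∈ ball (0 : ℂ) 1 := by
      rw [mem_ball_zero_iff, norm_mul]
      exact mul_lt_one_of_nonneg_of_lt_one_left (norm_nonneg _) ht1 hz1.le
    have hval : f (t * z) / f z = t * g (t * z) / g z := by
      rcases eq_or_ne t 0 with rfl | ht0
      · have := (hf 0 (by simp)).unique (hasSum_single 0 fun k hk ↦ by simp [hk])
        simp [this, ha0]
      · rw [hfg z hz0, hfg _ (mul_ne_zero ht0 hz0)]
        have := hg0 z hz
        field_simp
    have hsum : HasSum (fun k ↦ ((Pi.single 0 1 : ℕ → ℂ) k - a k * z ^ k / f z) * t ^ k)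
        (1 - t * g (t * z) / g z) := by
      have h0 : HasSum (fun k ↦ (Pi.single 0 1 : ℕ → ℂ) k * t ^ k) 1 := by
        have := hasSum_single (f := fun k ↦ (Pi.single 0 1 : ℕ → ℂ) k * t ^ k) 0
          fun k hk ↦ by simp [hk]
        simpa using this
      rw [← hval]
      refine (h0.sub ((hf _ htz).div_const (f z))).congr_fun fun k ↦ ?_
      rw [mul_pow]
      ring
    refine (hasSum_sum_range_mul_pow ht1 hsum).congr_fun fun k ↦ ?_
    rw [sum_sub_distrib, sum_div]
    simp [Pi.single_apply]
  set T : ℂ → ℂ := fun z ↦ ∑ k ∈ range n, a (k + 1) * z ^ k with hT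
  have hTf : ∀ z, z ≠ 0 → T z / g z = (∑ k ∈ range (n + 1), a k * z ^ k) / f z := by
    intro z hz0
    rw [sum_range_succ', ha0, zero_mul, add_zero, hfg z hz0, ← mul_div_mul_left _ _ hz0, hT]
    simp only [mul_sum, pow_succ]
    congr 1
    exact sum_congr rfl fun k _ ↦ by ring
  have hW : DifferentiableOn ℂ (fun z ↦ 1 - T z / g z) (ball 0 1) :=
    (DifferentiableOn.div (by fun_prop) hg hg0).const_sub 1
  have hW0 : 1 - T 0 / g 0 = 0 := by
    obtain ⟨m, rfl⟩ : ∃ m, n = m + 1 := ⟨n - 1, by lia⟩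
    simp [hT, hg1, sum_range_succ', ha1]
  intro z hz hz0
  have hz1 : ‖z‖ < 1 := by simpa using hz
  have hlt : ‖1 - (∑ k ∈ range (n + 1), a k * z ^ k) / f z‖ < 1 := by
    rw [← hTf z hz0]
    refine (Complex.norm_le_norm_of_mapsTo_ball hW (fun x hx ↦ ?_) hW0 hz1).trans_lt hz1
    rw [mem_closedBall_zero_iff]
    rcases eq_or_ne x 0 with rfl | hx0
    · simp [hW0]
    · rw [hTf x hx0]; exact hcoeff x hx hx0
  have hs : (∑ k ∈ range (n + 1), a k * z ^ k) ≠ 0 := by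
    intro h
    simp [h] at hlt
  refine ⟨hs, ?_⟩
  simpa only [inv_div] using half_lt_re_inv_of_norm_one_sub_lt_one hlt
end
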